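/- arXiv:2012.15011 — 3 statements merged into one kernel-verified Lean document; each statement's English description precedes it below -/
import Mathlib

section
/- Fix ℓ, n, m ≥ 1 and real numbers t_1,…,t_ℓ, x_1,…,x_n ∈ (0,1). Let (w_{ij}) for 1 ≤ i ≤ ℓ, 1 ≤ j ≤ n be independent random variables with geometric distributions P(w_{ij} = k) = (1 − t_i x_j)(t_i x_j)^k for k ∈ ℤ_{≥0}, and let G(ℓ,n) = max_Π Σ_{(i,j)∈Π} w_{ij}, the maximum over all lattice paths Π from (1,1) to (ℓ,n) each of whose steps increases exactly one coordinate by 1. Then P( G(ℓ,n) ≤ m ) = (∏_{i=1}^{ℓ} t_i^m) · (∏_{i=1}^{ℓ} ∏_{j=1}^{n} (1 − t_i x_j)) · s_{m^ℓ}(x_1,…,x_n, t_1^{−1},…,t_ℓ^{−1}), where s_{m^ℓ} is the Schur polynomial of the ℓ×m rectangular partition in the n+ℓ listed variables. -/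
open scoped Classical

noncomputable section

variable {R : Type*} [CommRing R]

/-- The boxes of the Young diagram with row lengths `lam 0, …, lam (ℓ-1)`
(a box in row `r < ℓ` and column `c < lam r`, both 0-indexed). -/
abbrev YBox (ℓ : ℕ) (lam : ℕ → ℕ) : Type := Σ r : Fin ℓ, Fin (lam r.1)

/-- A reverse plane partition of skew shape `lam/mu` with entries in `{1, …, n}`,
encoded as a filling of the boxes of `lam` by values in `Fin (n+1)`, where the
value `0` is used exactly on the boxes of `mu`; rows weakly increase and
columns weakly increase. -/
def IsSkewRPP (ℓ n : ℕ) (lam mu : ℕ → ℕ) (T : YBox ℓ lam → Fin (n + 1)) : Prop :=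
  (∀ b : YBox ℓ lam, ((T b : ℕ) = 0 ↔ (b.2 : ℕ) < mu b.1.1)) ∧
  (∀ (r : Fin ℓ) (c c' : Fin (lam r.1)), mu r.1 ≤ (c : ℕ) → (c : ℕ) ≤ (c' : ℕ) →
    T ⟨r, c⟩ ≤ T ⟨r, c'⟩) ∧
  (∀ (r r' : Fin ℓ) (c : Fin (lam r.1)) (c' : Fin (lam r'.1)),
    (r : ℕ) ≤ (r' : ℕ) → (c : ℕ) = (c' : ℕ) → mu r.1 ≤ (c : ℕ) → mu r'.1 ≤ (c' : ℕ) →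
    T ⟨r, c⟩ ≤ T ⟨r', c'⟩)

/-- The weight of a box `b` of the skew shape `lam/mu` in a reverse plane
partition `T`: it is `t (r+1)` (`r+1` being the 1-indexed row of `b`) if the box
directly below `b` exists (in `lam`) and carries the same entry, and `x e`
otherwise, where `e ∈ {1, …, n}` is the entry of `b`.  Boxes of `mu` have
weight `1`. -/
def boxWeight (ℓ n : ℕ) (lam mu : ℕ → ℕ) (x t : ℕ → R)
    (T : YBox ℓ lam → Fin (n + 1)) (b : YBox ℓ lam) : R :=
  if mu b.1.1 ≤ (b.2 : ℕ) then
    if ∃ (hr : (b.1 : ℕ) + 1 < ℓ) (hc : (b.2 : ℕ) < lam ((b.1 : ℕ) + 1)),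
        T ⟨⟨(b.1 : ℕ) + 1, hr⟩, ⟨(b.2 : ℕ), hc⟩⟩ = T b
      then t ((b.1 : ℕ) + 1)
      else x (T b : ℕ)
  else 1

/-- The (skew) refined dual Grothendieck polynomial `g_{lam/mu}(x; t)`:
the sum of `∏_r t_r^{b_r(T)} ∏_i x_i^{a_i(T)}` over all reverse plane
partitions `T` of shape `lam/mu` with entries in `{1, …, n}`, where `b_r(T)`
is the number of boxes in row `r` whose entry equals that of the box directly
below it, and `a_i(T)` is the number of columns containing the entry `i`. -/
def dualGroth (ℓ n : ℕ) (lam mu : ℕ → ℕ) (x t : ℕ → R) : R :=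
  ∑ T ∈ Finset.univ.filter (IsSkewRPP ℓ n lam mu),
    ∏ b : YBox ℓ lam, boxWeight ℓ n lam mu x t T b

/-- Complete homogeneous symmetric function `h_k` of the entries of a list. -/
def hL (k : ℕ) (L : List R) : R :=
  ∑ f ∈ Finset.univ.filter (fun f : Fin k → Fin L.length => Monotone f),
    ∏ i, L.get (f i)

/-- Elementary symmetric function `e_k` of the entries of a list. -/
def eL (k : ℕ) (L : List R) : R :=
  ∑ f ∈ Finset.univ.filter (fun f : Fin k → Fin L.length => StrictMono f),
    ∏ i, L.get (f i)

/-- `h_d` for an integer degree `d`, with `h_d = 0` for `d < 0`. -/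
def hInt (d : ℤ) (L : List R) : R := if 0 ≤ d then hL d.toNat L else 0

/-- `e_d` for an integer degree `d`, with `e_d = 0` for `d < 0`. -/
def eInt (d : ℤ) (L : List R) : R := if 0 ≤ d then eL d.toNat L else 0

/-- Extend a function on `Fin ℓ` to `ℕ` by `0`. -/
def extendFin (ℓ : ℕ) (p : Fin ℓ → ℕ) : ℕ → ℕ :=
  fun r => if h : r < ℓ then p ⟨r, h⟩ else 0

/-- A semistandard Young tableau of shape `lam` with entries in `{1, …, N}`
(encoded with values in `Fin (N+1)`, the value `0` being unused): rows weakly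
increase and columns strictly increase. -/
def IsSSYT (ℓ N : ℕ) (lam : ℕ → ℕ) (T : YBox ℓ lam → Fin (N + 1)) : Prop :=
  (∀ b : YBox ℓ lam, 1 ≤ (T b : ℕ)) ∧
  (∀ (r : Fin ℓ) (c c' : Fin (lam r.1)), (c : ℕ) ≤ (c' : ℕ) → T ⟨r, c⟩ ≤ T ⟨r, c'⟩) ∧
  (∀ (r r' : Fin ℓ) (c : Fin (lam r.1)) (c' : Fin (lam r'.1)),
    (r : ℕ) < (r' : ℕ) → (c : ℕ) = (c' : ℕ) → T ⟨r, c⟩ < T ⟨r', c'⟩)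

/-- The Schur polynomial `s_lam (z 1, …, z N)`: the sum of `z^T` over all
semistandard Young tableaux of shape `lam` with entries in `{1, …, N}`. -/
def schurPoly (ℓ N : ℕ) (lam : ℕ → ℕ) (z : ℕ → R) : R :=
  ∑ T ∈ Finset.univ.filter (IsSSYT ℓ N lam),
    ∏ b : YBox ℓ lam, z (T b : ℕ)


/-- A lattice path from `(1,1)` to `(m,n)` each of whose steps increases
exactly one coordinate by `1`, encoded as the sequence of its `m+n-1`
visited points. -/
def IsLPPPath (m n : ℕ) (f : Fin (m + n - 1) → Fin (m + 1) × Fin (n + 1)) : Prop :=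
  (∀ k : Fin (m + n - 1), (k : ℕ) = 0 → ((f k).1 : ℕ) = 1 ∧ ((f k).2 : ℕ) = 1) ∧
  (∀ k : Fin (m + n - 1), (k : ℕ) = m + n - 2 → ((f k).1 : ℕ) = m ∧ ((f k).2 : ℕ) = n) ∧
  (∀ k l : Fin (m + n - 1), (l : ℕ) = (k : ℕ) + 1 →
    ((((f l).1 : ℕ) = ((f k).1 : ℕ) + 1 ∧ ((f l).2 : ℕ) = ((f k).2 : ℕ)) ∨
      (((f l).1 : ℕ) = ((f k).1 : ℕ) ∧ ((f l).2 : ℕ) = ((f k).2 : ℕ) + 1)))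

/-- The last passage time `G(m,n) = max_Π Σ_{(i,j) ∈ Π} w_{ij}`, the maximum
over all lattice paths from `(1,1)` to `(m,n)` with unit up/right steps. -/
def lppTime (w : ℕ → ℕ → ℕ) (m n : ℕ) : ℕ :=
  (Finset.univ.filter (IsLPPPath m n)).sup fun f =>
    ∑ k : Fin (m + n - 1), w ((f k).1 : ℕ) ((f k).2 : ℕ)

/-- Extend a matrix `w : Fin ℓ → Fin n → ℕ` (0-indexed) to a function on
1-indexed coordinates, by `0` outside the box. -/
def extW (ℓ n : ℕ) (w : Fin ℓ → Fin n → ℕ) : ℕ → ℕ → ℕ := fun i j =>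
  if hi : i - 1 < ℓ then if hj : j - 1 < n then w ⟨i - 1, hi⟩ ⟨j - 1, hj⟩ else 0
  else 0

/-- The growth diagram of a matrix `w` of nonnegative integers: `growth w i j` is the shape
attached by the Robinson–Schensted–Knuth correspondence to the first `i` rows and the first `j`
columns of `w`, as the sequence of its parts. -/
def growth (w : ℕ → ℕ → ℕ) : ℕ → ℕ → ℕ → ℕ
  | 0, _, _ => 0
  | _ + 1, 0, _ => 0
  | i + 1, j + 1, 0 => max (growth w i (j + 1) 0) (growth w (i + 1) j 0) + w i j
  | i + 1, j + 1, k + 1 =>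
    max (growth w i (j + 1) (k + 1)) (growth w (i + 1) j (k + 1)) +
      min (growth w i (j + 1) k) (growth w (i + 1) j k) - growth w i j k

/-- The sequences `a` and `b` interlace: `b 0 ≥ a 0 ≥ b 1 ≥ a 1 ≥ ⋯`. -/
def Interlace (a b : ℕ → ℕ) : Prop := ∀ k, a k ≤ b k ∧ b (k + 1) ≤ a k

section Growth

variable (w : ℕ → ℕ → ℕ)

@[simp] lemma growth_zero_left (j k : ℕ) : growth w 0 j k = 0 := by simp [growth]

@[simp] lemma growth_zero_right (i k : ℕ) : growth w i 0 k = 0 := by cases i <;> simp [growth]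

lemma growth_interlace (i j : ℕ) :
    Interlace (growth w i j) (growth w (i + 1) j) ∧
      Interlace (growth w i j) (growth w i (j + 1)) := by
  induction i generalizing j with
  | zero =>
    refine ⟨?_, fun k => by simp⟩
    induction j with
    | zero => exact fun k => by simp
    | succ j ih =>
      intro k
      have h := (ih k).2
      cases k <;> simp_all [growth]
  | succ i ihi =>
    induction j with
    | zero =>
      refine ⟨fun k => by simp, fun k => ?_⟩
      have h := ((ihi 0).2 k).2
      cases k <;> simp_all [growth]
    | succ j ihj =>
      have key (i j : ℕ) (h1 : Interlace (growth w i j) (growth w (i + 1) j))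
          (h2 : Interlace (growth w i j) (growth w i (j + 1))) :
          Interlace (growth w (i + 1) j) (growth w (i + 1) (j + 1)) ∧
          Interlace (growth w i (j + 1)) (growth w (i + 1) (j + 1)) := by
        refine ⟨fun k => ?_, fun k => ?_⟩ <;>
        · have a := h1 k
          have b := h2 k
          rcases k with _ | k
          · simp only [growth]
            omega
          · have c := h1 (k + 1)
            have d := h2 (k + 1)
            have e := h1 k
            have f := h2 k
            simp only [growth]
            omega
      have h1 := key (i + 1) j ihj.1 ihj.2
      exact ⟨h1.2, (key i (j + 1) (ihi _).1 (ihi _).2).1⟩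

lemma growth_eq_zero {i j k : ℕ} (h : i ≤ k) : growth w i j k = 0 := by
  induction i generalizing k with
  | zero => simp
  | succ i ih =>
    obtain ⟨k, rfl⟩ : ∃ l, k = l + 1 := ⟨k - 1, by omega⟩
    have := ((growth_interlace w i j).1 k).2
    rw [ih (by omega)] at this
    omega

lemma growth_le_growth_of_le {i i' j j' : ℕ} (hi : i ≤ i') (hj : j ≤ j') :
    growth w i j 0 ≤ growth w i' j' 0 :=
  (monotone_nat_of_le_succ (fun i => ((growth_interlace w i j).1 0).1) hi).trans
    (monotone_nat_of_le_succ (fun j => ((growth_interlace w i' j).2 0).1) hj)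

lemma growth_le_first (i j k : ℕ) : growth w i j k ≤ growth w i j 0 :=
  antitone_nat_of_succ_le (fun k => ((growth_interlace w i j).1 k).2.trans'
    ((growth_interlace w i j).1 (k + 1)).1) (Nat.zero_le k)

lemma growth_congr {w w' : ℕ → ℕ → ℕ} {p q : ℕ} (h : ∀ i < p, ∀ j < q, w i j = w' i j) {i j : ℕ}
    (hi : i ≤ p) (hj : j ≤ q) : growth w i j = growth w' i j := by
  induction i generalizing j with
  | zero => funext k; simp
  | succ i ihi =>
    induction j with
    | zero => funext k; simp
    | succ j ihj =>
      funext k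
      cases k <;> simp only [growth, ihi (Nat.le_of_succ_le hi) hj, ihj (Nat.le_of_succ_le hj),
        ihi (Nat.le_of_succ_le hi) (Nat.le_of_succ_le hj), h i hi j hj]

/-- The size of the shape `growth w i j`, whenever `i ≤ p`. -/
def growthSize (p i j : ℕ) : ℕ := ∑ k ∈ Finset.range p, growth w i j k

lemma growthSize_succ_succ {p i j : ℕ} (h : i < p) :
    growthSize w p (i + 1) (j + 1) + growthSize w p i j =
      growthSize w p (i + 1) j + growthSize w p i (j + 1) + w i j := by
  obtain ⟨q, rfl⟩ : ∃ q, p = q + 1 := ⟨p - 1, by omega⟩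
  have partial_sum (q : ℕ) :
      growthSize w (q + 1) (i + 1) (j + 1) + growthSize w q i j +
          min (growth w (i + 1) j q) (growth w i (j + 1) q) =
        growthSize w (q + 1) (i + 1) j + growthSize w (q + 1) i (j + 1) + w i j := by
    induction q with
    | zero => simp [growthSize, growth]; omega
    | succ q ih =>
      simp only [growthSize, Finset.sum_range_succ _ (q + 1), Finset.sum_range_succ _ q] at ih ⊢
      have h1 := ((growth_interlace w i j).1 q).1
      have h2 := ((growth_interlace w i j).2 q).1
      simp only [growth]
      omega
  have h1 := partial_sum q
  have h2 : growth w i j q = 0 := growth_eq_zero w (by omega)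
  have h3 : growth w i (j + 1) q = 0 := growth_eq_zero w (by omega)
  have h4 : growthSize w (q + 1) i j = growthSize w q i j + growth w i j q :=
    Finset.sum_range_succ _ _
  omega

lemma growthSize_succ_left {p i : ℕ} (h : i < p) (j : ℕ) :
    growthSize w p (i + 1) j = growthSize w p i j + ∑ b ∈ Finset.range j, w i b := by
  induction j with
  | zero => simp [growthSize]
  | succ j ih =>
    have := growthSize_succ_succ w (j := j) h
    rw [Finset.sum_range_succ]
    omega

lemma growthSize_succ_right {p i : ℕ} (h : i ≤ p) (j : ℕ) :
    growthSize w p i (j + 1) = growthSize w p i j + ∑ a ∈ Finset.range i, w a j := by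
  induction i with
  | zero => simp [growthSize]
  | succ i ih =>
    have := growthSize_succ_succ w (p := p) (i := i) (j := j) (by omega)
    have := ih (by omega)
    rw [Finset.sum_range_succ]
    omega

/-- A growth diagram is determined by the shapes on the two far sides of the rectangle. -/
lemma growth_eq_of_boundary {w w' : ℕ → ℕ → ℕ} {p q : ℕ}
    (hrow : ∀ j ≤ q, growth w p j = growth w' p j)
    (hcol : ∀ i ≤ p, growth w i q = growth w' i q) {i j : ℕ} (hi : i ≤ p) (hj : j ≤ q) :
    growth w i j = growth w' i j := by
  induction hi using Nat.decreasingInduction generalizing j with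
  | self => exact hrow j hj
  | of_succ i hi ihi =>
    induction hj using Nat.decreasingInduction with
    | self => exact hcol i hi.le
    | of_succ j hj ihj =>
      funext k
      have h1 := congrFun (ihi hj) (k + 1)
      have h2 := ((growth_interlace w i j).1 k).1
      have h3 := ((growth_interlace w i j).2 k).1
      have h4 := ((growth_interlace w' i j).1 k).1
      have h5 := ((growth_interlace w' i j).2 k).1
      have h6 := congrFun (ihi hj.le) k
      have h7 := congrFun (ihi hj.le) (k + 1)
      have h8 := congrFun ihj k
      have h9 := congrFun ihj (k + 1)
      simp only [growth] at h1
      omega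

lemma eq_of_growth_boundary_eq {w w' : ℕ → ℕ → ℕ} {p q : ℕ}
    (hrow : ∀ j ≤ q, growth w p j = growth w' p j)
    (hcol : ∀ i ≤ p, growth w i q = growth w' i q) {i j : ℕ} (hi : i < p) (hj : j < q) :
    w i j = w' i j := by
  have h1 := congrFun (growth_eq_of_boundary hrow hcol (i := i + 1) (j := j + 1) hi hj) 0
  have h2 := congrFun (growth_eq_of_boundary hrow hcol (j := j + 1) hi.le hj) 0
  have h3 := congrFun (growth_eq_of_boundary hrow hcol (i := i + 1) hi hj.le) 0
  simp only [growth] at h1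
  omega

end Growth

/-- The growth diagram reconstructed from its boundary. The indices `a` and `b` count the rows and
columns from the far corner; `P a` are the shapes on the last column, `Q b` on the last row. -/
def backGrowth (P Q : ℕ → ℕ → ℕ) : ℕ → ℕ → ℕ → ℕ
  | 0, b, k => Q b k
  | a + 1, 0, k => P (a + 1) k
  | a + 1, b + 1, k =>
    max (backGrowth P Q (a + 1) b (k + 1)) (backGrowth P Q a (b + 1) (k + 1)) +
      min (backGrowth P Q (a + 1) b k) (backGrowth P Q a (b + 1) k) - backGrowth P Q a b (k + 1)

section BackGrowth

variable {P Q : ℕ → ℕ → ℕ}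

lemma backGrowth_interlace (hPQ : P 0 = Q 0) (hP : ∀ a, Interlace (P (a + 1)) (P a))
    (hQ : ∀ b, Interlace (Q (b + 1)) (Q b)) (a b : ℕ) :
    Interlace (backGrowth P Q (a + 1) b) (backGrowth P Q a b) ∧
      Interlace (backGrowth P Q a (b + 1)) (backGrowth P Q a b) := by
  have key (a b : ℕ) (h1 : Interlace (backGrowth P Q (a + 1) b) (backGrowth P Q a b))
      (h2 : Interlace (backGrowth P Q a (b + 1)) (backGrowth P Q a b)) :
      Interlace (backGrowth P Q (a + 1) (b + 1)) (backGrowth P Q (a + 1) b) ∧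
      Interlace (backGrowth P Q (a + 1) (b + 1)) (backGrowth P Q a (b + 1)) := by
    refine ⟨fun k => ?_, fun k => ?_⟩ <;>
    · have c := h1 (k + 1)
      have d := h2 (k + 1)
      have e := h1 k
      have f := h2 k
      simp only [backGrowth]
      omega
  induction a generalizing b with
  | zero =>
    have hright (b : ℕ) : Interlace (backGrowth P Q 0 (b + 1)) (backGrowth P Q 0 b) := fun k => by
      simpa only [backGrowth] using hQ b k
    refine ⟨?_, hright b⟩
    induction b with
    | zero => exact fun k => by simpa only [backGrowth, ← hPQ] using hP 0 k
    | succ b ih => exact (key 0 b ih (hright b)).2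
  | succ a iha =>
    have hright (b : ℕ) : Interlace (backGrowth P Q (a + 1) (b + 1)) (backGrowth P Q (a + 1) b) :=
      (key a b (iha b).1 (iha b).2).1
    refine ⟨?_, hright b⟩
    induction b with
    | zero => exact fun k => by simpa only [backGrowth] using hP (a + 1) k
    | succ b ih => exact (key (a + 1) b ih (hright b)).2

/-- Interlacing chains of partitions decreasing to zero are the boundary of a growth diagram. -/
lemma exists_growth_eq {p q : ℕ} (hPQ : P 0 = Q 0) (hP : ∀ a, Interlace (P (a + 1)) (P a))
    (hQ : ∀ b, Interlace (Q (b + 1)) (Q b)) (hP0 : P p = 0) (hQ0 : Q q = 0) :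
    ∃ w : ℕ → ℕ → ℕ, (∀ a ≤ p, growth w (p - a) q = P a) ∧
      ∀ b ≤ q, growth w p (q - b) = Q b := by
  set M := backGrowth P Q
  have hM (a b : ℕ) : Interlace (M (a + 1) b) (M a b) ∧ Interlace (M a (b + 1)) (M a b) :=
    backGrowth_interlace hPQ hP hQ a b
  have M_zero (b : ℕ) : M 0 b = Q b := by funext k; simp [M, backGrowth]
  have zero_M (a : ℕ) : M a 0 = P a := by
    funext k; cases a <;> simp [M, backGrowth, hPQ]
  have row (b k : ℕ) : M p b k = 0 := by
    have := antitone_nat_of_succ_le (f := fun b => M p b k) (fun b => ((hM p b).2 k).1)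
      (Nat.zero_le b)
    simpa [zero_M, hP0] using this
  have col (a k : ℕ) : M a q k = 0 := by
    have := antitone_nat_of_succ_le (f := fun a => M a q k) (fun a => ((hM a q).1 k).1)
      (Nat.zero_le a)
    simpa [M_zero, hQ0] using this
  set w : ℕ → ℕ → ℕ := fun i j =>
    M (p - (i + 1)) (q - (j + 1)) 0 - max (M (p - i) (q - (j + 1)) 0) (M (p - (i + 1)) (q - j) 0)
  have main (i j k : ℕ) (hi : i ≤ p) (hj : j ≤ q) : growth w i j k = M (p - i) (q - j) k := by
    induction i generalizing j k with
    | zero => simp [row]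
    | succ i ihi =>
      induction j generalizing k with
      | zero => simp [col]
      | succ j ihj =>
        obtain ⟨a, ha⟩ : ∃ a, p = a + (i + 1) := ⟨p - (i + 1), by omega⟩
        obtain ⟨b, hb⟩ : ∃ b, q = b + (j + 1) := ⟨q - (j + 1), by omega⟩
        have e1 : p - (i + 1) = a := by omega
        have e2 : p - i = a + 1 := by omega
        have e3 : q - (j + 1) = b := by omega
        have e4 : q - j = b + 1 := by omega
        cases k with
        | zero =>
          have h1 := (hM a b).1 0
          have h2 := (hM a b).2 0
          rw [growth, ihi _ _ (by omega) hj, ihj _ (by omega)]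
          simp only [w, e1, e2, e3, e4]
          omega
        | succ k =>
          rw [growth, ihi _ _ (by omega) hj, ihj _ (by omega), ihi _ _ (by omega) hj,
            ihj _ (by omega), ihi _ _ (by omega) (by omega)]
          have h1 := (hM a b).1 k
          have h2 := (hM a b).2 k
          have h3 : M (a + 1) (b + 1) k = max (M (a + 1) b (k + 1)) (M a (b + 1) (k + 1)) +
            min (M (a + 1) b k) (M a (b + 1) k) - M a b (k + 1) := by
            simp only [M, backGrowth]
          have h4 := (hM a b).1 (k + 1)
          have h5 := (hM a b).2 (k + 1)
          simp only [e1, e2, e3, e4]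
          omega
  refine ⟨w, fun a ha => ?_, fun b hb => ?_⟩
  · funext k
    rw [main _ _ _ (by omega) le_rfl, Nat.sub_self, zero_M, Nat.sub_sub_self ha]
  · funext k
    rw [main _ _ _ le_rfl (by omega), Nat.sub_self, M_zero, Nat.sub_sub_self hb]

end BackGrowth

section LastPassage

/-- A lattice path from `(1, 1)` to `(i, j)`, parametrized by `ℕ`. -/
def IsNatPath (i j : ℕ) (p : ℕ → ℕ × ℕ) : Prop :=
  p 0 = (1, 1) ∧ p (i + j - 2) = (i, j) ∧
    (∀ k, k + 1 ≤ i + j - 2 → p (k + 1) = ((p k).1 + 1, (p k).2) ∨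
      p (k + 1) = ((p k).1, (p k).2 + 1)) ∧
    ∀ k ≤ i + j - 2, (p k).1 ≤ i ∧ (p k).2 ≤ j

lemma IsNatPath.extend {i j i' j' : ℕ} {p : ℕ → ℕ × ℕ} (hp : IsNatPath i j p) (hi : 1 ≤ i)
    (hj : 1 ≤ j) (h : (i', j') = (i + 1, j) ∨ (i', j') = (i, j + 1)) (w : ℕ → ℕ → ℕ) :
    ∃ p', IsNatPath i' j' p' ∧
      ∑ k ∈ Finset.range (i' + j' - 1), w (p' k).1 (p' k).2 =
        ∑ k ∈ Finset.range (i + j - 1), w (p k).1 (p k).2 + w i' j' := by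
  obtain ⟨h0, h1, h2, h3⟩ := hp
  have hs : i' + j' - 2 = i + j - 1 := by
    rcases h with h | h <;> (obtain ⟨rfl, rfl⟩ := Prod.mk.inj h; omega)
  have hs' : i' + j' - 1 = i + j - 1 + 1 := by
    rcases h with h | h <;> (obtain ⟨rfl, rfl⟩ := Prod.mk.inj h; omega)
  have hle : i ≤ i' ∧ j ≤ j' := by
    rcases h with h | h <;> (obtain ⟨rfl, rfl⟩ := Prod.mk.inj h; omega)
  refine ⟨fun k => if k < i + j - 1 then p k else (i', j'), ⟨?_, ?_, ?_, ?_⟩, ?_⟩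
  · simp [show 0 < i + j - 1 by omega, h0]
  · simp [hs]
  · intro k hk
    rw [hs] at hk
    simp only [show k < i + j - 1 by omega, if_true]
    rcases hk.lt_or_eq with hk' | hk'
    · simp only [hk', if_true]
      exact h2 k (by omega)
    · rw [if_neg (by omega), show k = i + j - 2 by omega, h1]
      exact h
  · intro k hk
    dsimp only
    split_ifs with hk'
    · exact ⟨(h3 k (by omega)).1.trans hle.1, (h3 k (by omega)).2.trans hle.2⟩
    · exact ⟨le_rfl, le_rfl⟩
  · rw [hs', Finset.sum_range_succ]
    congr 1
    · refine Finset.sum_congr rfl fun k hk => ?_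
      simp [Finset.mem_range.1 hk]
    · simp

lemma exists_isNatPath_growth (w : ℕ → ℕ → ℕ) (i j : ℕ) :
    ∃ p, IsNatPath (i + 1) (j + 1) p ∧ ∑ k ∈ Finset.range (i + 1 + (j + 1) - 1),
      w (p k).1 (p k).2 = growth (fun a b => w (a + 1) (b + 1)) (i + 1) (j + 1) 0 := by
  set u : ℕ → ℕ → ℕ := fun a b => w (a + 1) (b + 1)
  induction i generalizing j with
  | zero =>
    induction j with
    | zero => exact ⟨fun _ => (1, 1), by simp [IsNatPath], by simp [growth, u]⟩
    | succ j ih =>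
      obtain ⟨p, hp, hsum⟩ := ih
      obtain ⟨p', hp', hsum'⟩ := hp.extend (by omega) (by omega) (Or.inr rfl) w
      exact ⟨p', hp', by rw [hsum', hsum]; simp [growth.eq_3, u]⟩
  | succ i ihi =>
    induction j with
    | zero =>
      obtain ⟨p, hp, hsum⟩ := ihi 0
      obtain ⟨p', hp', hsum'⟩ := hp.extend (by omega) (by omega) (Or.inl rfl) w
      exact ⟨p', hp', by rw [hsum', hsum, growth.eq_3 _ (i + 1)]; simp [u]⟩
    | succ j ihj =>
      rw [growth]
      rcases le_total (growth u (i + 1) (j + 2) 0) (growth u (i + 2) (j + 1) 0) with h | h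
      · obtain ⟨p, hp, hsum⟩ := ihj
        obtain ⟨p', hp', hsum'⟩ := hp.extend (by omega) (by omega) (Or.inr rfl) w
        exact ⟨p', hp', by rw [hsum', hsum, max_eq_right h]⟩
      · obtain ⟨p, hp, hsum⟩ := ihi (j + 1)
        obtain ⟨p', hp', hsum'⟩ := hp.extend (by omega) (by omega) (Or.inl rfl) w
        exact ⟨p', hp', by rw [hsum', hsum, max_eq_left h]⟩

lemma IsLPPPath.one_le {i j : ℕ} {f : Fin (i + j - 1) → Fin (i + 1) × Fin (j + 1)}
    (hf : IsLPPPath i j f) (k : ℕ) (hk : k < i + j - 1) :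
    1 ≤ ((f ⟨k, hk⟩).1 : ℕ) ∧ 1 ≤ ((f ⟨k, hk⟩).2 : ℕ) := by
  induction k with
  | zero => have := hf.1 ⟨0, hk⟩ rfl; omega
  | succ k ih =>
    have := ih (by omega)
    have := hf.2.2 ⟨k, by omega⟩ ⟨k + 1, hk⟩ rfl
    omega

lemma IsLPPPath.sum_le_growth {i j : ℕ} {f : Fin (i + j - 1) → Fin (i + 1) × Fin (j + 1)}
    (hf : IsLPPPath i j f) (w : ℕ → ℕ → ℕ) (k : ℕ) (hk : k < i + j - 1) :
    ∑ q : Fin (k + 1), w (f ⟨q, by omega⟩).1 (f ⟨q, by omega⟩).2 ≤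
      growth (fun a b => w (a + 1) (b + 1)) (f ⟨k, hk⟩).1 (f ⟨k, hk⟩).2 0 := by
  set u : ℕ → ℕ → ℕ := fun a b => w (a + 1) (b + 1)
  have hrec (a b : ℕ) (ha : 1 ≤ a) (hb : 1 ≤ b) :
      growth u a b 0 = max (growth u (a - 1) b 0) (growth u a (b - 1) 0) + w a b := by
    obtain ⟨a, rfl⟩ : ∃ c, a = c + 1 := ⟨a - 1, by omega⟩
    obtain ⟨b, rfl⟩ : ∃ c, b = c + 1 := ⟨b - 1, by omega⟩
    simp only [growth, u, Nat.add_sub_cancel]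
  have hpos := hf.one_le k hk
  rw [hrec _ _ hpos.1 hpos.2, Fin.sum_univ_castSucc]
  refine Nat.add_le_add ?_ le_rfl
  induction k with
  | zero => simp
  | succ k ih =>
    have hpos' := hf.one_le k (by omega)
    have h := ih (by omega) hpos'
    rw [Fin.sum_univ_castSucc]
    refine (Nat.add_le_add_right h _).trans ?_
    refine (hrec _ _ hpos'.1 hpos'.2).ge.trans ?_
    rcases hf.2.2 ⟨k, by omega⟩ ⟨k + 1, hk⟩ rfl with h' | h'
    · rw [h'.1, h'.2, Nat.add_sub_cancel]
      exact le_max_left _ _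
    · rw [h'.1, h'.2, Nat.add_sub_cancel]
      exact le_max_right _ _

lemma lppTime_eq_growth (w : ℕ → ℕ → ℕ) {i j : ℕ} (hi : 1 ≤ i) (hj : 1 ≤ j) :
    lppTime w i j = growth (fun a b => w (a + 1) (b + 1)) i j 0 := by
  obtain ⟨i, rfl⟩ : ∃ c, i = c + 1 := ⟨i - 1, by omega⟩
  obtain ⟨j, rfl⟩ : ∃ c, j = c + 1 := ⟨j - 1, by omega⟩
  refine le_antisymm (Finset.sup_le fun f hf => ?_) ?_
  · have hf := (Finset.mem_filter.1 hf).2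
    have h := hf.sum_le_growth w (i + j) (by omega)
    have hend := hf.2.1 ⟨i + j, by omega⟩ (by simp only; omega)
    rw [hend.1, hend.2] at h
    refine le_trans (le_of_eq ?_) h
    exact Fintype.sum_equiv (finCongr (by omega)) _ _ fun _ => rfl
  · obtain ⟨p, ⟨h0, h1, h2, h3⟩, hsum⟩ := exists_isNatPath_growth w i j
    rw [← hsum, Finset.sum_range]
    refine Finset.le_sup (f := fun f : Fin (i + 1 + (j + 1) - 1) →
      Fin (i + 1 + 1) × Fin (j + 1 + 1) => ∑ k, w (f k).1 (f k).2) (b := fun k =>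
        (⟨(p k).1, Nat.lt_succ_of_le (h3 k (by omega)).1⟩,
          ⟨(p k).2, Nat.lt_succ_of_le (h3 k (by omega)).2⟩)) ?_
    refine Finset.mem_filter.2 ⟨Finset.mem_univ _, fun k hk => ?_, fun k hk => ?_,
      fun k l hl => ?_⟩
    · simp [hk, h0]
    · simp [hk, h1]
    · simp only
      rw [hl]
      rcases h2 k (by omega) with h | h <;> simp [h]

end LastPassage

/-- The Gelfand–Tsetlin pattern of an `ℓ × m` rectangular tableau with `N` letters: `c r k` is the
number of entries at most `k` in row `r`. -/
structure IsGT (ℓ m N : ℕ) (c : ℕ → ℕ → ℕ) : Prop where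
  zero_right (r : ℕ) : c r 0 = 0
  le_succ (r k : ℕ) : c r k ≤ c r (k + 1)
  succ_succ_le (r k : ℕ) : c (r + 1) (k + 1) ≤ c r k
  eq_zero {r : ℕ} (k : ℕ) (hr : ℓ ≤ r) : c r k = 0
  eq_width {r k : ℕ} (hr : r < ℓ) (hk : N ≤ k) : c r k = m

/-- The number of boxes with entry at most `k`. -/
def gtSize (ℓ : ℕ) (c : ℕ → ℕ → ℕ) (k : ℕ) : ℕ := ∑ r ∈ Finset.range ℓ, c r k

/-- The monomial of a Gelfand–Tsetlin pattern. -/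
def gtWeight {N : ℕ} (ℓ : ℕ) (c : ℕ → ℕ → ℕ) (z : Fin N → R) : R :=
  ∏ k : Fin N, z k ^ (gtSize ℓ c (k + 1) - gtSize ℓ c k)

/-- The sum of `gtWeight` over all Gelfand–Tsetlin patterns. -/
def gtSum (ℓ m N : ℕ) (z : Fin N → ℝ) : ℝ :=
  ∑' c : {c : ℕ → ℕ → ℕ // IsGT ℓ m N c}, gtWeight ℓ c.1 z

section Tableaux

variable {ℓ m N : ℕ}

lemma IsGT.mono {c : ℕ → ℕ → ℕ} (hc : IsGT ℓ m N c) (r : ℕ) : Monotone (c r) :=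
  monotone_nat_of_le_succ (hc.le_succ r)

lemma IsGT.le_width {c : ℕ → ℕ → ℕ} (hc : IsGT ℓ m N c) (r k : ℕ) : c r k ≤ m := by
  by_cases hr : r < ℓ
  · exact (hc.mono r (le_max_left k N)).trans_eq (hc.eq_width hr (le_max_right k N))
  · simp [hc.eq_zero k (not_lt.1 hr)]

lemma IsGT.gtSize_mono {c : ℕ → ℕ → ℕ} (hc : IsGT ℓ m N c) : Monotone (gtSize ℓ c) :=
  fun _ _ h => Finset.sum_le_sum fun r _ => hc.mono r h

lemma lt_card_filter_le_iff {f : Fin m → ℕ} (hf : Monotone f) (k : ℕ) (j : Fin m) :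
    (j : ℕ) < (Finset.univ.filter fun i => f i ≤ k).card ↔ f j ≤ k := by
  constructor
  · intro h
    by_contra hj
    have : (Finset.univ.filter fun i => f i ≤ k) ⊆ Finset.Iio j := fun i hi => by
      simp only [Finset.mem_filter, Finset.mem_univ, true_and, Finset.mem_Iio] at hi ⊢
      exact lt_of_not_ge fun hji => hj ((hf hji).trans hi)
    have := Finset.card_le_card this
    rw [Fin.card_Iio] at this
    omega
  · intro h
    have : Finset.Iic j ⊆ Finset.univ.filter fun i => f i ≤ k := fun i hi => by
      simp only [Finset.mem_filter, Finset.mem_univ, true_and, Finset.mem_Iic] at hi ⊢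
      exact (hf hi).trans h
    have := Finset.card_le_card this
    rw [Fin.card_Iic] at this
    omega

/-- The number of entries at most `k` in row `r` of a filling of the `ℓ × m` rectangle. -/
def rowCount (T : YBox ℓ (fun _ => m) → Fin (N + 1)) (r k : ℕ) : ℕ :=
  if hr : r < ℓ then (Finset.univ.filter fun j : Fin m => (T ⟨⟨r, hr⟩, j⟩ : ℕ) ≤ k).card else 0

lemma IsSSYT.lt_rowCount_iff {T : YBox ℓ (fun _ => m) → Fin (N + 1)}
    (hT : IsSSYT ℓ N (fun _ => m) T) (r : Fin ℓ) (k : ℕ) (j : Fin m) :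
    (j : ℕ) < rowCount T r k ↔ (T ⟨r, j⟩ : ℕ) ≤ k := by
  rw [rowCount, dif_pos r.2]
  exact lt_card_filter_le_iff (f := fun j => (T ⟨r, j⟩ : ℕ)) (fun a b h => hT.2.1 r a b h) k j

lemma rowCount_le (T : YBox ℓ (fun _ => m) → Fin (N + 1)) (r k : ℕ) : rowCount T r k ≤ m := by
  rw [rowCount]
  split_ifs
  · exact (Finset.card_filter_le _ _).trans_eq (by simp)
  · exact Nat.zero_le m

lemma IsSSYT.isGT_rowCount {T : YBox ℓ (fun _ => m) → Fin (N + 1)}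
    (hT : IsSSYT ℓ N (fun _ => m) T) : IsGT ℓ m N (rowCount T) where
  zero_right r := by
    rw [rowCount]
    split_ifs with hr
    · rw [Finset.card_eq_zero, Finset.filter_eq_empty_iff]
      intro j _
      have := hT.1 ⟨⟨r, hr⟩, j⟩
      omega
    · rfl
  le_succ r k := by
    simp only [rowCount]
    split_ifs with hr
    · exact Finset.card_le_card (Finset.monotone_filter_right _ fun j _ hj => Nat.le_succ_of_le hj)
    · rfl
  succ_succ_le r k := by
    by_cases hr : r + 1 < ℓ
    · refine le_of_forall_lt fun j hj => ?_
      have hjm := hj.trans_le (rowCount_le T _ _)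
      have h1 := (hT.lt_rowCount_iff ⟨r + 1, hr⟩ (k + 1) ⟨j, hjm⟩).1 hj
      refine (hT.lt_rowCount_iff ⟨r, by omega⟩ k ⟨j, hjm⟩).2 ?_
      have h2 := hT.2.2 ⟨r, by omega⟩ ⟨r + 1, hr⟩ ⟨j, hjm⟩ ⟨j, hjm⟩ (Nat.lt_succ_self r) rfl
      have h3 : (T ⟨⟨r, by omega⟩, ⟨j, hjm⟩⟩ : ℕ) < T ⟨⟨r + 1, hr⟩, ⟨j, hjm⟩⟩ := h2
      omega
    · simp [rowCount, hr]
  eq_zero k hr := by simp [rowCount, not_lt.2 hr]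
  eq_width hr hk := by
    rw [rowCount, dif_pos hr, Finset.filter_true_of_mem, Finset.card_univ, Fintype.card_fin]
    intro j _
    omega

lemma rowCount_injOn : Set.InjOn (rowCount (ℓ := ℓ) (m := m) (N := N))
    {T | IsSSYT ℓ N (fun _ => m) T} := by
  intro T hT T' hT' h
  funext ⟨r, j⟩
  have key (k : ℕ) : (T ⟨r, j⟩ : ℕ) ≤ k ↔ (T' ⟨r, j⟩ : ℕ) ≤ k := by
    rw [← IsSSYT.lt_rowCount_iff hT, ← IsSSYT.lt_rowCount_iff hT', h]
  exact Fin.ext (le_antisymm ((key _).2 le_rfl) ((key _).1 le_rfl))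

lemma IsGT.exists_rowCount_eq {c : ℕ → ℕ → ℕ} (hc : IsGT ℓ m N c) :
    ∃ T : YBox ℓ (fun _ => m) → Fin (N + 1), IsSSYT ℓ N (fun _ => m) T ∧ rowCount T = c := by
  have hex (b : YBox ℓ (fun _ => m)) : ∃ k, (b.2 : ℕ) < c b.1 k :=
    ⟨N, by rw [hc.eq_width b.1.2 le_rfl]; exact b.2.2⟩
  have hle (b : YBox ℓ (fun _ => m)) (k : ℕ) : Nat.find (hex b) ≤ k ↔ (b.2 : ℕ) < c b.1 k := by
    rw [Nat.find_le_iff]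
    exact ⟨fun ⟨q, hq, h⟩ => h.trans_le (hc.mono _ hq), fun h => ⟨k, le_rfl, h⟩⟩
  refine ⟨fun b => ⟨Nat.find (hex b), Nat.lt_succ_of_le ((hle b N).2 ?_)⟩, ⟨?_, ?_, ?_⟩, ?_⟩
  · rw [hc.eq_width b.1.2 le_rfl]
    exact b.2.2
  · intro b
    rw [Nat.one_le_iff_ne_zero, ← Nat.pos_iff_ne_zero, ← not_le, hle, hc.zero_right]
    exact Nat.not_lt_zero _
  · intro r j j' hj
    rw [Fin.mk_le_mk, hle]
    exact hj.trans_lt ((hle ⟨r, j'⟩ _).1 le_rfl)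
  · intro r r' j j' hr hj
    have strict (s : ℕ) (k : ℕ) (h : (j : ℕ) < c s k) (hs : r < s) : (j : ℕ) < c r (k - 1) := by
      obtain ⟨d, rfl⟩ : ∃ d, s = r + 1 + d := ⟨s - (r + 1), by omega⟩
      induction d generalizing k with
      | zero =>
        cases k with
        | zero => simp [hc.zero_right] at h
        | succ k => exact h.trans_le (hc.succ_succ_le _ _)
      | succ d ih =>
        refine ih k ?_ (by omega)
        cases k with
        | zero => simp [hc.zero_right] at h
        | succ k =>
          exact (h.trans_le (hc.succ_succ_le _ _)).trans_le (hc.le_succ _ _)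
    have h := (hle ⟨r', j'⟩ _).1 le_rfl
    rw [Fin.mk_lt_mk]
    have hpos : Nat.find (hex ⟨r', j'⟩) ≠ 0 := fun h0 => by
      rw [h0, hc.zero_right] at h
      exact Nat.not_lt_zero _ h
    have := (hle ⟨r, j⟩ _).2 (strict r' _ (by simpa only [hj] using h) hr)
    omega
  · funext r k
    rw [rowCount]
    split_ifs with hr
    · rw [Finset.filter_congr (q := fun j : Fin m => (j : ℕ) < c r k)
        fun j _ => hle ⟨⟨r, hr⟩, j⟩ k, Fin.card_filter_val_lt]
      exact min_eq_right (hc.le_width r k)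
    · exact (hc.eq_zero k (not_lt.1 hr)).symm

lemma IsSSYT.prod_eq_gtWeight {T : YBox ℓ (fun _ => m) → Fin (N + 1)}
    (hT : IsSSYT ℓ N (fun _ => m) T) (z : ℕ → R) :
    ∏ b, z (T b : ℕ) = gtWeight ℓ (rowCount T) (fun k : Fin N => z (k + 1)) := by
  have hGT := hT.isGT_rowCount
  have row (r : Fin ℓ) : ∏ j : Fin m, z (T ⟨r, j⟩ : ℕ) =
      ∏ k : Fin N, z (k + 1) ^ (rowCount T r (k + 1) - rowCount T r k) := by
    have hmem (j : Fin m) : (T ⟨r, j⟩ : ℕ) - 1 < N := by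
      have := hT.1 ⟨r, j⟩
      omega
    rw [← Finset.prod_fiberwise (s := Finset.univ)
      (g := fun j : Fin m => (⟨(T ⟨r, j⟩ : ℕ) - 1, hmem j⟩ : Fin N))]
    refine Finset.prod_congr rfl fun k _ => ?_
    rw [Finset.prod_congr rfl (g := fun _ => z (k + 1)), Finset.prod_const]
    · congr 1
      simp only [rowCount, r.2, dif_pos]
      rw [← Finset.card_sdiff_of_subset
        (Finset.monotone_filter_right _ fun j _ hj => Nat.le_succ_of_le hj)]
      congr 1
      ext j
      have := hT.1 ⟨r, j⟩
      simp only [Finset.mem_filter, Finset.mem_univ, true_and, Finset.mem_sdiff, Fin.ext_iff,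
        Fin.eta]
      omega
    · intro j hj
      have := hT.1 ⟨r, j⟩
      have h := Fin.ext_iff.1 (Finset.mem_filter.1 hj).2
      simp only at h
      congr 1
      omega
  rw [Fintype.prod_sigma, Finset.prod_congr rfl fun r _ => row r, Finset.prod_comm, gtWeight]
  refine Finset.prod_congr rfl fun k _ => ?_
  rw [Finset.prod_pow_eq_pow_sum, gtSize, gtSize,
    ← Finset.sum_tsub_distrib _ fun r _ => hGT.le_succ r k, Finset.sum_range]

lemma schurPoly_eq_gtSum (z : ℕ → ℝ) :
    schurPoly ℓ N (fun _ => m) z = gtSum ℓ m N fun k => z (k + 1) := by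
  rw [schurPoly, ← Finset.sum_coe_sort, ← tsum_fintype (L := .unconditional _), gtSum]
  let e : {T // T ∈ Finset.univ.filter (IsSSYT ℓ N fun _ => m)} →
      {c : ℕ → ℕ → ℕ // IsGT ℓ m N c} :=
    fun T => ⟨rowCount T.1, (Finset.mem_filter.1 T.2).2.isGT_rowCount⟩
  have he : Function.Bijective e := by
    refine ⟨fun T T' h => Subtype.ext ?_, fun c => ?_⟩
    · exact rowCount_injOn (Finset.mem_filter.1 T.2).2 (Finset.mem_filter.1 T'.2).2
        (Subtype.ext_iff.1 h)
    · obtain ⟨T, hT, h⟩ := c.2.exists_rowCount_eq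
      exact ⟨⟨T, Finset.mem_filter.2 ⟨Finset.mem_univ _, hT⟩⟩, Subtype.ext h⟩
  rw [← (Equiv.ofBijective e he).tsum_eq]
  exact tsum_congr fun T => (Finset.mem_filter.1 T.2).2.prod_eq_gtWeight z

end Tableaux

/-- The Bender–Knuth involution exchanging the letters `q + 1` and `q + 2`, on Gelfand–Tsetlin
patterns. -/
def benderKnuth (q : ℕ) (c : ℕ → ℕ → ℕ) (r k : ℕ) : ℕ :=
  if k = q + 1 then
    max (c r q) (c (r + 1) (q + 1 + 1)) +
      (if r = 0 then c 0 (q + 1 + 1) else min (c r (q + 1 + 1)) (c (r - 1) q)) - c r (q + 1)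
  else c r k

section BenderKnuth

variable {ℓ m N q : ℕ} {c : ℕ → ℕ → ℕ}

@[simp] lemma benderKnuth_of_ne {k : ℕ} (hk : k ≠ q + 1) (r : ℕ) : benderKnuth q c r k = c r k :=
  if_neg hk

lemma IsGT.benderKnuth_zero (hc : IsGT ℓ m N c) :
    benderKnuth q c 0 (q + 1) + c 0 (q + 1) = max (c 0 q) (c 1 (q + 1 + 1)) + c 0 (q + 1 + 1) := by
  have := hc.le_succ 0 (q + 1)
  simp only [benderKnuth, if_true, zero_add]
  omega

lemma IsGT.benderKnuth_succ (hc : IsGT ℓ m N c) (r : ℕ) :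
    benderKnuth q c (r + 1) (q + 1) + c (r + 1) (q + 1) =
      max (c (r + 1) q) (c (r + 1 + 1) (q + 1 + 1)) + min (c (r + 1) (q + 1 + 1)) (c r q) := by
  have := hc.le_succ (r + 1) (q + 1)
  have := hc.succ_succ_le r q
  simp only [benderKnuth, if_true, Nat.add_sub_cancel, Nat.succ_ne_zero, if_false]
  omega

lemma IsGT.benderKnuth (hc : IsGT ℓ m N c) (hq : q + 1 < N) :
    IsGT ℓ m N (benderKnuth q c) where
  zero_right r := by rw [benderKnuth_of_ne (by omega), hc.zero_right]
  le_succ r k := by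
    have h1 := hc.le_succ r q
    have h2 := hc.le_succ r (q + 1)
    have h3 := hc.succ_succ_le r (q + 1)
    rcases eq_or_ne k q with rfl | hk
    · rw [benderKnuth_of_ne (by omega)]
      cases r with
      | zero => have := hc.benderKnuth_zero (q := k); simp only [zero_add] at h3; omega
      | succ r =>
        have := hc.benderKnuth_succ (q := k) r
        have := hc.succ_succ_le r k
        omega
    · rcases eq_or_ne k (q + 1) with rfl | hk'
      · rw [benderKnuth_of_ne (k := q + 1 + 1) (by omega)]
        cases r with
        | zero => have := hc.benderKnuth_zero (q := q); simp only [zero_add] at h3; omega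
        | succ r => have := hc.benderKnuth_succ (q := q) r; omega
      · rw [benderKnuth_of_ne hk', benderKnuth_of_ne (by omega)]
        exact hc.le_succ r k
  succ_succ_le r k := by
    have h1 := hc.le_succ r q
    have h2 := hc.le_succ r (q + 1)
    have h3 := hc.succ_succ_le r (q + 1)
    rcases eq_or_ne k q with rfl | hk
    · rw [benderKnuth_of_ne (k := k) (by omega)]
      have := hc.benderKnuth_succ (q := k) r
      have := hc.le_succ (r + 1) k
      have := hc.succ_succ_le (r + 1) (k + 1)
      omega
    · rcases eq_or_ne k (q + 1) with rfl | hk'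
      · rw [benderKnuth_of_ne (k := q + 1 + 1) (by omega)]
        cases r with
        | zero => have := hc.benderKnuth_zero (q := q); simp only [zero_add] at h3 ⊢; omega
        | succ r =>
          have := hc.benderKnuth_succ (q := q) r
          have := hc.succ_succ_le r q
          omega
      · rw [benderKnuth_of_ne hk', benderKnuth_of_ne (by omega)]
        exact hc.succ_succ_le r k
  eq_zero {r} k hr := by
    rcases eq_or_ne k (q + 1) with rfl | hk
    · cases r with
      | zero => simp [_root_.benderKnuth, hc.eq_zero (r := 0) _ hr, hc.eq_zero (r := 1) _ (by omega)]
      | succ r =>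
        have := hc.benderKnuth_succ (q := q) r
        have := hc.eq_zero q hr
        have := hc.eq_zero (q + 1 + 1) hr
        have := hc.eq_zero (r := r + 1 + 1) (q + 1 + 1) (by omega)
        omega
    · rw [benderKnuth_of_ne hk, hc.eq_zero k hr]
  eq_width hr hk := by rw [benderKnuth_of_ne (by omega), hc.eq_width hr hk]

lemma IsGT.benderKnuth_benderKnuth (hc : IsGT ℓ m N c) (hq : q + 1 < N) :
    _root_.benderKnuth q (_root_.benderKnuth q c) = c := by
  funext r k
  rcases eq_or_ne k (q + 1) with rfl | hk
  · cases r with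
    | zero =>
      have h1 := hc.benderKnuth_zero (q := q)
      have h2 := (hc.benderKnuth hq).benderKnuth_zero (q := q)
      simp only [benderKnuth_of_ne (q := q) (k := q) (by omega),
        benderKnuth_of_ne (q := q) (k := q + 1 + 1) (by omega)] at h2
      omega
    | succ r =>
      have h1 := hc.benderKnuth_succ (q := q) r
      have h2 := (hc.benderKnuth hq).benderKnuth_succ (q := q) r
      simp only [benderKnuth_of_ne (q := q) (k := q) (by omega),
        benderKnuth_of_ne (q := q) (k := q + 1 + 1) (by omega)] at h2
      omega
  · rw [benderKnuth_of_ne hk, benderKnuth_of_ne hk]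

lemma gtSize_benderKnuth_of_ne {k : ℕ} (hk : k ≠ q + 1) :
    gtSize ℓ (benderKnuth q c) k = gtSize ℓ c k :=
  Finset.sum_congr rfl fun r _ => benderKnuth_of_ne hk r

lemma IsGT.gtSize_benderKnuth (hc : IsGT ℓ m N c) :
    gtSize ℓ (_root_.benderKnuth q c) (q + 1) + gtSize ℓ c (q + 1) =
      gtSize ℓ c q + gtSize ℓ c (q + 1 + 1) := by
  have partial_sum (p : ℕ) :
      gtSize (p + 1) (_root_.benderKnuth q c) (q + 1) + gtSize (p + 1) c (q + 1) +
          min (c p q) (c (p + 1) (q + 1 + 1)) =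
        gtSize (p + 1) c q + gtSize (p + 1 + 1) c (q + 1 + 1) := by
    induction p with
    | zero =>
      have := hc.benderKnuth_zero (q := q)
      simp only [gtSize, Finset.sum_range_succ, Finset.sum_range_zero, zero_add]
      omega
    | succ p ih =>
      have := hc.benderKnuth_succ (q := q) p
      simp only [gtSize, Finset.sum_range_succ _ (p + 1 + 1), Finset.sum_range_succ _ (p + 1)]
        at ih ⊢
      omega
  cases ℓ with
  | zero => simp [gtSize]
  | succ p =>
    have h1 := partial_sum p
    have h2 := hc.eq_zero (q + 1 + 1) le_rfl
    have h3 : gtSize (p + 1 + 1) c (q + 1 + 1) = gtSize (p + 1) c (q + 1 + 1) + c (p + 1) (q + 1 + 1) :=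
      Finset.sum_range_succ _ _
    omega

lemma IsGT.gtWeight_benderKnuth {N : ℕ} (hc : IsGT ℓ m (N + 1) c) (i : Fin N)
    (z : Fin (N + 1) → R) :
    gtWeight ℓ (_root_.benderKnuth i c) z =
      gtWeight ℓ c (z ∘ Equiv.swap i.castSucc i.succ) := by
  rw [gtWeight, gtWeight, ← Equiv.prod_comp (Equiv.swap i.castSucc i.succ)]
  refine Finset.prod_congr rfl fun k _ => ?_
  have h := hc.gtSize_benderKnuth (q := i)
  have h0 : gtSize ℓ (_root_.benderKnuth i c) i = gtSize ℓ c i :=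
    gtSize_benderKnuth_of_ne (by omega)
  have h2 : gtSize ℓ (_root_.benderKnuth i c) (i + 1 + 1) = gtSize ℓ c (i + 1 + 1) :=
    gtSize_benderKnuth_of_ne (by omega)
  simp only [Function.comp_apply]
  congr 1
  rcases eq_or_ne k i.castSucc with rfl | hk
  · simp only [Equiv.swap_apply_left, Fin.val_succ, Fin.val_castSucc]
    omega
  · rcases eq_or_ne k i.succ with rfl | hk'
    · simp only [Equiv.swap_apply_right, Fin.val_succ, Fin.val_castSucc]
      omega
    · rw [Equiv.swap_apply_of_ne_of_ne hk hk']
      have h3 : (k : ℕ) ≠ i := fun h => hk (Fin.ext h)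
      have h4 : (k : ℕ) ≠ i + 1 := fun h => hk' (Fin.ext h)
      rw [gtSize_benderKnuth_of_ne h4, gtSize_benderKnuth_of_ne (by omega)]

lemma gtSum_comp_swap {N : ℕ} (i : Fin N) (z : Fin (N + 1) → ℝ) :
    gtSum ℓ m (N + 1) (z ∘ Equiv.swap i.castSucc i.succ) = gtSum ℓ m (N + 1) z := by
  have hi : (i : ℕ) + 1 < N + 1 := by omega
  let e : {c : ℕ → ℕ → ℕ // IsGT ℓ m (N + 1) c} ≃ {c : ℕ → ℕ → ℕ // IsGT ℓ m (N + 1) c} :=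
    Function.Involutive.toPerm (fun c => ⟨benderKnuth i c.1, c.2.benderKnuth hi⟩)
      fun c => Subtype.ext (c.2.benderKnuth_benderKnuth hi)
  rw [gtSum, gtSum, ← e.tsum_eq fun c => gtWeight ℓ c.1 z]
  exact tsum_congr fun c => (c.2.gtWeight_benderKnuth i z).symm

lemma gtSum_comp_perm (σ : Equiv.Perm (Fin N)) (z : Fin N → ℝ) :
    gtSum ℓ m N (z ∘ σ) = gtSum ℓ m N z := by
  cases N with
  | zero => rw [Subsingleton.elim (z ∘ σ) z]
  | succ N =>
    have hσ : σ ∈ Submonoid.closure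
        (Set.range fun i : Fin N => Equiv.swap i.castSucc i.succ) := by
      rw [Equiv.Perm.mclosure_swap_castSucc_succ]
      trivial
    induction hσ using Submonoid.closure_induction generalizing z with
    | mem σ h =>
      obtain ⟨i, rfl⟩ := h
      exact gtSum_comp_swap i z
    | one => rfl
    | mul σ τ _ _ hσ hτ =>
      rw [Equiv.Perm.coe_mul, ← Function.comp_assoc, hτ, hσ]

end BenderKnuth

section Correspondence

/-- The Gelfand–Tsetlin pattern read off the boundary of the growth diagram of `w` on `ℓ` rows and
`n` columns, completing the shapes to the `ℓ × m` rectangle. -/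
def boundaryPattern (ℓ n m : ℕ) (w : ℕ → ℕ → ℕ) (r k : ℕ) : ℕ :=
  if r < ℓ then
    if r < k - n then m else growth w (ℓ - (k - n)) (min k n) (r - (k - n))
  else 0

variable {ℓ n m : ℕ} {w : ℕ → ℕ → ℕ}

lemma boundaryPattern_of_le {k : ℕ} (hk : k ≤ n) (r : ℕ) :
    boundaryPattern ℓ n m w r k = growth w ℓ k r := by
  rw [boundaryPattern, Nat.sub_eq_zero_of_le hk, min_eq_left hk]
  split_ifs with h1 h2
  · omega
  · rfl
  · exact (growth_eq_zero w (not_lt.1 h1)).symm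

lemma boundaryPattern_add (s r : ℕ) : boundaryPattern ℓ n m w r (n + s) =
    if r < ℓ then if r < s then m else growth w (ℓ - s) n (r - s) else 0 := by
  rw [boundaryPattern, Nat.add_sub_cancel_left, min_eq_right (Nat.le_add_right n s)]

lemma boundaryPattern_congr {w' : ℕ → ℕ → ℕ} (h : ∀ i < ℓ, ∀ j < n, w i j = w' i j) :
    boundaryPattern ℓ n m w = boundaryPattern ℓ n m w' := by
  funext r k
  simp only [boundaryPattern, growth_congr h (Nat.sub_le ℓ (k - n)) (min_le_right k n)]

lemma isGT_boundaryPattern (hw : growth w ℓ n 0 ≤ m) :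
    IsGT ℓ m (n + ℓ) (boundaryPattern ℓ n m w) where
  zero_right r := by rw [boundaryPattern_of_le (Nat.zero_le n), growth_zero_right]
  le_succ r k := by
    rcases lt_or_ge k n with hk | hk
    · rw [boundaryPattern_of_le hk.le, boundaryPattern_of_le hk]
      exact ((growth_interlace w ℓ k).2 r).1
    · obtain ⟨s, rfl⟩ := Nat.exists_eq_add_of_le hk
      rw [add_assoc, boundaryPattern_add, boundaryPattern_add]
      split_ifs with h1 h2 h3 h3
      · rfl
      · omega
      · exact (growth_le_first w _ _ _).trans
          ((growth_le_growth_of_le w (Nat.sub_le _ _) le_rfl).trans hw)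
      · have h := ((growth_interlace w (ℓ - (s + 1)) n).1 (r - (s + 1))).2
        rwa [show ℓ - (s + 1) + 1 = ℓ - s by omega, show r - (s + 1) + 1 = r - s by omega] at h
      · rfl
  succ_succ_le r k := by
    rcases lt_or_ge k n with hk | hk
    · rw [boundaryPattern_of_le hk.le, boundaryPattern_of_le hk]
      exact ((growth_interlace w ℓ k).2 r).2
    · obtain ⟨s, rfl⟩ := Nat.exists_eq_add_of_le hk
      rw [add_assoc, boundaryPattern_add, boundaryPattern_add]
      split_ifs <;> try omega
      rw [show ℓ - s = ℓ - (s + 1) + 1 by omega, Nat.add_sub_add_right]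
      exact ((growth_interlace w (ℓ - (s + 1)) n).1 (r - s)).1
  eq_zero k hr := if_neg (not_lt.2 hr)
  eq_width hr hk := by rw [boundaryPattern, if_pos hr, if_pos (by omega)]

lemma gtSize_boundaryPattern_of_le {k : ℕ} (hk : k ≤ n) :
    gtSize ℓ (boundaryPattern ℓ n m w) k = growthSize w ℓ ℓ k :=
  Finset.sum_congr rfl fun r _ => boundaryPattern_of_le hk r

lemma gtSize_boundaryPattern_add {s : ℕ} (hs : s ≤ ℓ) :
    gtSize ℓ (boundaryPattern ℓ n m w) (n + s) = s * m + growthSize w ℓ (ℓ - s) n := by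
  have h (p i : ℕ) (hi : i ≤ p) :
      growthSize w p i n = ∑ k ∈ Finset.range i, growth w i n k := by
    rw [growthSize, ← Finset.sum_range_add_sum_Ico _ hi, Finset.sum_eq_zero (s := Finset.Ico i p),
      add_zero]
    exact fun k hk => growth_eq_zero w (Finset.mem_Ico.1 hk).1
  rw [h _ _ (Nat.sub_le _ _), gtSize, ← Finset.sum_range_add_sum_Ico _ hs,
    Finset.sum_Ico_eq_sum_range]
  congr 1
  · rw [Finset.sum_congr rfl (g := fun _ => m), Finset.sum_const, Finset.card_range, smul_eq_mul]
    intro r hr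
    have hr := Finset.mem_range.1 hr
    rw [boundaryPattern_add, if_pos (by omega), if_pos hr]
  · refine Finset.sum_congr rfl fun r hr => ?_
    have hr := Finset.mem_range.1 hr
    rw [boundaryPattern_add, if_pos (by omega), if_neg (by omega), Nat.add_sub_cancel_left]

lemma gtWeight_boundaryPattern (hw : growth w ℓ n 0 ≤ m) (x t : ℕ → ℝ)
    (ht : ∀ i < ℓ, t i ≠ 0) :
    (∏ i : Fin ℓ, t i ^ m) *
        gtWeight ℓ (boundaryPattern ℓ n m w)
          (Fin.append (fun j : Fin n => x j) fun i : Fin ℓ => (t i.rev)⁻¹) =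
      ∏ i : Fin ℓ, ∏ j : Fin n, (t i * x j) ^ w i j := by
  have hrow (i : Fin ℓ) : t i ^ m * (t i)⁻¹ ^
      (gtSize ℓ (boundaryPattern ℓ n m w) (n + i.rev + 1) -
        gtSize ℓ (boundaryPattern ℓ n m w) (n + i.rev)) = t i ^ ∑ j : Fin n, w i j := by
    have hmono := (isGT_boundaryPattern hw).gtSize_mono (Nat.le_succ (n + i.rev))
    have hs := growthSize_succ_left w i.2 n
    rw [Nat.succ_eq_add_one, add_assoc, gtSize_boundaryPattern_add i.rev.2.le,
      gtSize_boundaryPattern_add (Nat.succ_le_of_lt i.rev.2)] at hmono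
    rw [add_assoc, gtSize_boundaryPattern_add i.rev.2.le,
      gtSize_boundaryPattern_add (Nat.succ_le_of_lt i.rev.2)]
    have e1 : ℓ - (i.rev : ℕ) = i + 1 := by rw [Fin.val_rev]; omega
    have e2 : ℓ - ((i.rev : ℕ) + 1) = i := by rw [Fin.val_rev]; omega
    rw [Nat.succ_eq_add_one, e1, e2, hs, add_mul, one_mul, Finset.sum_range] at hmono
    rw [Nat.succ_eq_add_one, e1, e2, hs, add_mul, one_mul, Finset.sum_range]
    have hle : ∑ j : Fin n, w i j ≤ m := by omega
    rw [show ∀ a b c : ℕ, a + m + b - (a + (b + c)) = m - c by omega, inv_pow,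
      mul_inv_eq_iff_eq_mul₀ (pow_ne_zero _ (ht i i.2)), ← pow_add]
    congr 1
    omega
  have hcol (j : Fin n) : gtSize ℓ (boundaryPattern ℓ n m w) (j + 1) -
      gtSize ℓ (boundaryPattern ℓ n m w) j = ∑ i : Fin ℓ, w i j := by
    rw [gtSize_boundaryPattern_of_le j.2.le, gtSize_boundaryPattern_of_le j.2,
      Nat.succ_eq_add_one, growthSize_succ_right w le_rfl, Nat.add_sub_cancel_left,
      Finset.sum_range]
  simp only [mul_pow, Finset.prod_mul_distrib, Finset.prod_pow_eq_pow_sum]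
  rw [gtWeight, Fin.prod_univ_add]
  simp only [Fin.append_left, Fin.append_right, Fin.val_castAdd, Fin.val_natAdd, hcol]
  rw [← Equiv.prod_comp Fin.revPerm (fun i : Fin ℓ => (t (i.rev : Fin ℓ))⁻¹ ^ _), mul_left_comm,
    ← Finset.prod_mul_distrib, mul_comm]
  congr 1
  · exact Finset.prod_congr rfl fun i _ => by simpa using hrow i
  · rw [Finset.prod_comm]
    exact Finset.prod_congr rfl fun j _ => (Finset.prod_pow_eq_pow_sum _ _ _).symm

lemma IsGT.exists_boundaryPattern_eq {c : ℕ → ℕ → ℕ} (hc : IsGT ℓ m (n + ℓ) c) :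
    ∃ w : ℕ → ℕ → ℕ, growth w ℓ n 0 ≤ m ∧ boundaryPattern ℓ n m w = c := by
  have hlast (b : ℕ) : Interlace (fun k => c k (n - (b + 1))) (fun k => c k (n - b)) := fun k => by
    rcases Nat.eq_zero_or_pos (n - b) with h | h
    · simp [h, show n - (b + 1) = 0 by omega, hc.zero_right]
    · simp only [show n - b = n - (b + 1) + 1 by omega]
      exact ⟨hc.le_succ _ _, hc.succ_succ_le _ _⟩
  obtain ⟨w, hP, hQ⟩ := exists_growth_eq (P := fun a k => c (k + a) (n + a))
    (Q := fun b k => c k (n - b)) (p := ℓ) (q := n) rfl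
    (fun a k => ⟨by simpa only [add_assoc] using hc.succ_succ_le (k + a) (n + a), by
      simpa only [add_assoc, add_comm 1 a] using hc.le_succ (k + 1 + a) (n + a)⟩)
    hlast (funext fun k => hc.eq_zero _ (Nat.le_add_left _ _))
    (funext fun k => by simpa using hc.zero_right k)
  refine ⟨w, ?_, ?_⟩
  · rw [← Nat.sub_zero ℓ, hP 0 (Nat.zero_le _)]
    exact hc.le_width _ _
  · funext r k
    rcases le_total k n with hk | hk
    · have h := congrFun (hQ (n - k) (Nat.sub_le _ _)) r
      rw [boundaryPattern_of_le hk]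
      simpa only [Nat.sub_sub_self hk] using h
    · obtain ⟨s, rfl⟩ := Nat.exists_eq_add_of_le hk
      rw [boundaryPattern_add]
      split_ifs with h1 h2
      · refine (le_antisymm (hc.le_width _ _) ?_).symm
        have diag (d : ℕ) : c (r + d) (n + s + d) ≤ c r (n + s) := by
          induction d with
          | zero => rfl
          | succ d ih => exact (hc.succ_succ_le _ _).trans ih
        have h := diag (ℓ - 1 - r)
        rwa [hc.eq_width (by omega) (by omega)] at h
      · have h := congrFun (hP s (by omega)) (r - s)
        simpa only [Nat.sub_add_cancel (not_lt.1 h2)] using h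
      · exact (hc.eq_zero _ (not_lt.1 h1)).symm

lemma eq_of_boundaryPattern_eq {w' : ℕ → ℕ → ℕ}
    (h : boundaryPattern ℓ n m w = boundaryPattern ℓ n m w') {i j : ℕ} (hi : i < ℓ) (hj : j < n) :
    w i j = w' i j := by
  refine eq_of_growth_boundary_eq (p := ℓ) (q := n) (fun j hj => funext fun k => ?_)
    (fun i hi => funext fun k => ?_) hi hj
  · rw [← boundaryPattern_of_le (m := m) hj, h, boundaryPattern_of_le hj]
  · rcases lt_or_ge k i with hk | hk
    · have h' := congrFun₂ h (k + (ℓ - i)) (n + (ℓ - i))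
      simpa [boundaryPattern_add, show k + (ℓ - i) < ℓ by omega, Nat.sub_sub_self hi] using h'
    · rw [growth_eq_zero w hk, growth_eq_zero w' hk]

/-- Reindexing of matrices with last passage time at most `m` by Gelfand–Tsetlin patterns. -/
lemma tsum_lppTime_le_eq_gtSum (hl : 1 ≤ ℓ) (hn : 1 ≤ n) (x t : ℕ → ℝ) (ht : ∀ i < ℓ, t i ≠ 0) :
    ∑' w : {w : Fin ℓ → Fin n → ℕ // lppTime (extW ℓ n w) ℓ n ≤ m},
        ∏ i : Fin ℓ, ∏ j : Fin n, (t i * x j) ^ w.1 i j =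
      (∏ i : Fin ℓ, t i ^ m) *
        gtSum ℓ m (n + ℓ) (Fin.append (fun j : Fin n => x j) fun i : Fin ℓ => (t i)⁻¹) := by
  let u (w : Fin ℓ → Fin n → ℕ) (a b : ℕ) : ℕ := extW ℓ n w (a + 1) (b + 1)
  have hu (w) (i : Fin ℓ) (j : Fin n) : u w i j = w i j := by simp [u, extW]
  have hG (w) : lppTime (extW ℓ n w) ℓ n = growth (u w) ℓ n 0 := lppTime_eq_growth _ hl hn
  let e : {w : Fin ℓ → Fin n → ℕ // lppTime (extW ℓ n w) ℓ n ≤ m} →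
      {c : ℕ → ℕ → ℕ // IsGT ℓ m (n + ℓ) c} :=
    fun w => ⟨boundaryPattern ℓ n m (u w.1), isGT_boundaryPattern ((hG w.1).symm.trans_le w.2)⟩
  have he : Function.Bijective e := by
    refine ⟨fun w w' h => Subtype.ext ?_, fun c => ?_⟩
    · funext i j
      rw [← hu w.1 i j, ← hu w'.1 i j]
      exact eq_of_boundaryPattern_eq (Subtype.ext_iff.1 h) i.2 j.2
    · obtain ⟨w, hw, h⟩ := c.2.exists_boundaryPattern_eq
      have huw : ∀ i < ℓ, ∀ j < n, u (fun i j => w i j) i j = w i j :=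
        fun i hi j hj => hu _ ⟨i, hi⟩ ⟨j, hj⟩
      refine ⟨⟨fun i j => w i j, ?_⟩, Subtype.ext ?_⟩
      · rwa [hG, growth_congr huw le_rfl le_rfl]
      · exact (boundaryPattern_congr huw).trans h
  let σ : Equiv.Perm (Fin (n + ℓ)) :=
    finSumFinEquiv.permCongr (Equiv.sumCongr (Equiv.refl (Fin n)) Fin.revPerm)
  have hσ : Fin.append (fun j : Fin n => x j) (fun i : Fin ℓ => (t i)⁻¹) ∘ σ =
      Fin.append (fun j : Fin n => x j) fun i : Fin ℓ => (t i.rev)⁻¹ := by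
    funext k
    refine Fin.addCases (fun j => ?_) (fun i => ?_) k <;> simp [σ, Equiv.permCongr_apply]
  rw [← gtSum_comp_perm σ, hσ, gtSum, ← tsum_mul_left, ← (Equiv.ofBijective e he).tsum_eq]
  refine tsum_congr fun w => ?_
  rw [Equiv.ofBijective_apply, gtWeight_boundaryPattern ((hG w.1).symm.trans_le w.2) x t ht]
  simp only [hu]

end Correspondence

/-- **Distribution function of the last passage time as a Schur polynomial**
(Johansson; Baik–Rains).  With `w_{ij}` (`1 ≤ i ≤ ℓ`, `1 ≤ j ≤ n`) independent
geometric random variables, `P(w_{ij} = k) = (1 - t_i x_j)(t_i x_j)^k`, and the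
probability of an event being the sum over all configurations in the event of
`∏_{i,j} P(w_{ij})`:
`P(G(ℓ,n) ≤ m)
  = (∏_{i=1}^ℓ t_i^m) (∏_{i=1}^ℓ ∏_{j=1}^n (1 - t_i x_j))
      s_{m^ℓ}(x_1,…,x_n,t_1⁻¹,…,t_ℓ⁻¹)`. -/
theorem lpp_distribution_schur_measure
    (entryl n m : ℕ) (hl : 1 ≤ entryl) (hn : 1 ≤ n) (hm : 1 ≤ m) (t x : ℕ → ℝ)
    (ht : ∀ i : ℕ, 1 ≤ i → i ≤ entryl → 0 < t i ∧ t i < 1)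
    (hx : ∀ j : ℕ, 1 ≤ j → j ≤ n → 0 < x j ∧ x j < 1) :
    ∑' w : {w : Fin entryl → Fin n → ℕ // lppTime (extW entryl n w) entryl n ≤ m},
      ∏ i : Fin entryl, ∏ j : Fin n,
        (1 - t (i.1 + 1) * x (j.1 + 1)) * (t (i.1 + 1) * x (j.1 + 1)) ^ w.1 i j =
      (∏ i ∈ Finset.Icc 1 entryl, t i ^ m) *
        (∏ i ∈ Finset.Icc 1 entryl, ∏ j ∈ Finset.Icc 1 n, (1 - t i * x j)) *
        schurPoly entryl (n + entryl) (fun _ => m)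
          (fun k => if k ≤ n then x k else (t (k - n))⁻¹) := by
  have prod_Icc (p : ℕ) (f : ℕ → ℝ) : ∏ i ∈ Finset.Icc 1 p, f i = ∏ i : Fin p, f (i + 1) := by
    rw [← Finset.prod_range fun i => f (i + 1), Finset.range_eq_Ico, Finset.prod_Ico_add' f 0 p 1]
    rfl
  have hz : (fun k : Fin (n + entryl) =>
      if (k : ℕ) + 1 ≤ n then x (k + 1) else (t (k + 1 - n))⁻¹) =
      Fin.append (fun j : Fin n => x (j + 1)) fun i : Fin entryl => (t (i + 1))⁻¹ := by
    funext k
    refine Fin.addCases (fun j => ?_) (fun i => ?_) k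
    · simp [Nat.succ_le_of_lt j.2]
    · simp [add_assoc]
  have h := tsum_lppTime_le_eq_gtSum (m := m) hl hn (fun j => x (j + 1)) (fun i => t (i + 1))
    fun i hi => (ht (i + 1) (by omega) hi).1.ne'
  simp only [prod_Icc, Finset.prod_mul_distrib, tsum_mul_left, schurPoly_eq_gtSum, hz] at h ⊢
  rw [h]
  ring

end
end

section
/- Fix ℓ ≥ 1 and work in the field of rational functions in the indeterminates z_1,…,z_ℓ, t_1,…,t_{ℓ−1}. Define G_{ij} := ∏_{m=i}^{j−1} (1 − t_m z_i^{−1}) for j ≥ i (empty product = 1 when j = i) and G_{ij} := ∏_{m=j}^{i−1} (1 − t_m z_i^{−1})^{−1} for j < i. Then det[ z_i^{j−1} G_{ij} ]_{i,j=1}^{ℓ} = ∏_{1 ≤ i < j ≤ ℓ} (z_j − z_i)/(1 − t_i z_j^{−1}) = ∏_{1 ≤ i < j ≤ ℓ} (z_j − z_i) z_j/(z_j − t_i). -/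
noncomputable section

/-- The entries of the deformed Vandermonde matrix are, up to a factor depending only on the row,
values of the monic polynomials `∏_{m=1}^{j} (X - t_m)`. -/
theorem pow_mul_deformed_entry {F : Type*} [Field F] (t : ℕ → F) (z : F) (i j : ℕ) (hz : z ≠ 0)
    (hzt : ∀ m, 1 ≤ m → m ≤ i → z ≠ t m) :
    z ^ j *
        (if i ≤ j then ∏ m ∈ Finset.Icc (i + 1) j, (1 - t m * z⁻¹)
          else ∏ m ∈ Finset.Icc (j + 1) i, (1 - t m * z⁻¹)⁻¹) =
      (∏ m ∈ Finset.range i, (1 - t (m + 1) * z⁻¹)⁻¹) *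
        ∏ m ∈ Finset.range j, (z - t (m + 1)) := by
  have hne : ∏ m ∈ Finset.range i, (1 - t (m + 1) * z⁻¹) ≠ 0 := by
    refine Finset.prod_ne_zero_iff.2 fun m hm h => hzt (m + 1) (by omega) ?_ ?_
    · have := Finset.mem_range.1 hm
      omega
    · rwa [sub_eq_zero, eq_mul_inv_iff_mul_eq₀ hz, one_mul] at h
  have hpoly : ∏ m ∈ Finset.range j, (z - t (m + 1)) =
      z ^ j * ∏ m ∈ Finset.range j, (1 - t (m + 1) * z⁻¹) := by
    rw [← Finset.card_range j, ← Finset.prod_const, Finset.card_range, ← Finset.prod_mul_distrib]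
    exact Finset.prod_congr rfl fun m _ => by field_simp
  have hsplit : ∀ a b : ℕ, a ≤ b → ∏ m ∈ Finset.range b, (1 - t (m + 1) * z⁻¹) =
      (∏ m ∈ Finset.range a, (1 - t (m + 1) * z⁻¹)) *
        ∏ m ∈ Finset.Icc (a + 1) b, (1 - t m * z⁻¹) := by
    intro a b hab
    rw [← Finset.prod_range_mul_prod_Ico _ hab,
      Finset.prod_Ico_add' (fun m => 1 - t m * z⁻¹) a b 1, Finset.Ico_add_one_right_eq_Icc]
  rw [hpoly, Finset.prod_inv_distrib, Finset.prod_inv_distrib]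
  split_ifs with hij
  · rw [hsplit i j hij, mul_left_comm, inv_mul_cancel_left₀ hne]
  · have hji : j ≤ i := by omega
    rw [hsplit j i hji] at hne ⊢
    rw [mul_inv_rev, mul_left_comm, inv_mul_cancel_right₀ (left_ne_zero_of_mul hne)]

/-- A product over pairs `a < b` in `Fin n`, as an iterated product with `b` outermost, over natural
numbers below `b`. -/
theorem prod_filter_fst_lt_snd {M : Type*} [CommMonoid M] (n : ℕ) (f : ℕ → ℕ → M) :
    ∏ p ∈ Finset.univ.filter (fun p : Fin n × Fin n => p.1 < p.2), f p.1 p.2 =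
      ∏ b : Fin n, ∏ a ∈ Finset.range b, f a b := by
  rw [Finset.prod_filter, Fintype.prod_prod_type_right]
  refine Finset.prod_congr rfl fun b _ => ?_
  rw [← Finset.prod_filter]
  refine Finset.prod_bij (fun a _ => a.1) ?_ ?_ ?_ ?_
  · exact fun a ha => Finset.mem_range.2 (Finset.mem_filter.1 ha).2
  · exact fun a _ c _ h => Fin.ext h
  · intro a ha
    have := Finset.mem_range.1 ha
    exact ⟨⟨a, this.trans b.2⟩, Finset.mem_filter.2 ⟨Finset.mem_univ _, this⟩, rfl⟩
  · simp

/-- The deformed Vandermonde determinant as a product, with the denominators in terms of `z⁻¹`. -/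
theorem det_deformed_eq_prod_div {F : Type*} [Field F] (n : ℕ) (z t : ℕ → F)
    (hz : ∀ b : ℕ, 1 ≤ b → b ≤ n → z b ≠ 0)
    (hzt : ∀ m b : ℕ, 1 ≤ m → m < b → b ≤ n → z b ≠ t m) :
    Matrix.det (Matrix.of fun i j : Fin n =>
        z (i.1 + 1) ^ j.1 *
          (if i.1 ≤ j.1 then
              ∏ m ∈ Finset.Icc (i.1 + 1) j.1, (1 - t m * (z (i.1 + 1))⁻¹)
            else
              ∏ m ∈ Finset.Icc (j.1 + 1) i.1, (1 - t m * (z (i.1 + 1))⁻¹)⁻¹)) =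
        ∏ p ∈ Finset.univ.filter (fun p : Fin n × Fin n => p.1 < p.2),
          (z (p.2.1 + 1) - z (p.1.1 + 1)) / (1 - t (p.1.1 + 1) * (z (p.2.1 + 1))⁻¹) := by
  let P : Fin n → Polynomial F := fun j =>
    ∏ m ∈ Finset.range j, (Polynomial.X - Polynomial.C (t (m + 1)))
  have hdet := Matrix.det_eval_matrixOfPolynomials_eq_det_vandermonde
    (fun i : Fin n => z (i.1 + 1)) P
    (fun j => by simp [P, Polynomial.natDegree_finsetProd_X_sub_C_eq_card])
    (fun j => Polynomial.monic_prod_of_monic _ _ fun m _ => Polynomial.monic_X_sub_C _)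
  have hentry : (Matrix.of fun i j : Fin n =>
      z (i.1 + 1) ^ j.1 *
        (if i.1 ≤ j.1 then
            ∏ m ∈ Finset.Icc (i.1 + 1) j.1, (1 - t m * (z (i.1 + 1))⁻¹)
          else
            ∏ m ∈ Finset.Icc (j.1 + 1) i.1, (1 - t m * (z (i.1 + 1))⁻¹)⁻¹)) =
      Matrix.of fun i j : Fin n =>
        (∏ m ∈ Finset.range i, (1 - t (m + 1) * (z (i.1 + 1))⁻¹)⁻¹) *
          Matrix.of (fun i j : Fin n => (P j).eval (z (i.1 + 1))) i j := by
    ext i j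
    simp only [Matrix.of_apply, P, Polynomial.eval_prod, Polynomial.eval_sub, Polynomial.eval_X,
      Polynomial.eval_C]
    exact pow_mul_deformed_entry t _ _ _ (hz _ (by omega) (by omega))
      fun m h1 h2 => hzt m _ h1 (by omega) (by omega)
  have hvand : (∏ i : Fin n, ∏ j ∈ Finset.Ioi i, (z (j.1 + 1) - z (i.1 + 1))) =
      ∏ p ∈ Finset.univ.filter (fun p : Fin n × Fin n => p.1 < p.2),
        (z (p.2.1 + 1) - z (p.1.1 + 1)) := by
    rw [Finset.prod_filter, Fintype.prod_prod_type]
    refine Finset.prod_congr rfl fun i _ => ?_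
    rw [← Finset.prod_filter]
    exact Finset.prod_congr (by ext; simp) fun _ _ => rfl
  rw [hentry, Matrix.det_mul_column, ← hdet, Matrix.det_vandermonde, hvand,
    ← prod_filter_fst_lt_snd n fun a b => (1 - t (a + 1) * (z (b + 1))⁻¹)⁻¹,
    ← Finset.prod_mul_distrib]
  exact Finset.prod_congr rfl fun p _ => by rw [div_eq_mul_inv, mul_comm]

/-- **A `t`-deformation of the Vandermonde determinant.**
With `G_{ij} = ∏_{m=i}^{j-1} (1 - t_m z_i⁻¹)` for `j ≥ i` and
`G_{ij} = ∏_{m=j}^{i-1} (1 - t_m z_i⁻¹)⁻¹` for `j < i` (1-indexed),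
`det[ z_i^{j-1} G_{ij} ]_{i,j=1}^{ℓ}
  = ∏_{i<j} (z_j - z_i)/(1 - t_i z_j⁻¹)
  = ∏_{i<j} (z_j - z_i) z_j/(z_j - t_i)`,
in any field where the `z_b` are nonzero and `z_b ≠ t_m` for `m < b`. -/
theorem det_t_deformed_vandermonde
    {F : Type*} [Field F] (lgth : ℕ) (hl : 1 ≤ lgth) (z t : ℕ → F)
    (hz : ∀ b : ℕ, 1 ≤ b → b ≤ lgth → z b ≠ 0)
    (hzt : ∀ m b : ℕ, 1 ≤ m → m < b → b ≤ lgth → z b ≠ t m) :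
    Matrix.det (Matrix.of fun i j : Fin lgth =>
        z (i.1 + 1) ^ j.1 *
          (if i.1 ≤ j.1 then
              ∏ m ∈ Finset.Icc (i.1 + 1) j.1, (1 - t m * (z (i.1 + 1))⁻¹)
            else
              ∏ m ∈ Finset.Icc (j.1 + 1) i.1, (1 - t m * (z (i.1 + 1))⁻¹)⁻¹)) =
        ∏ p ∈ Finset.univ.filter (fun p : Fin lgth × Fin lgth => p.1 < p.2),
          (z (p.2.1 + 1) - z (p.1.1 + 1)) / (1 - t (p.1.1 + 1) * (z (p.2.1 + 1))⁻¹) ∧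
      Matrix.det (Matrix.of fun i j : Fin lgth =>
        z (i.1 + 1) ^ j.1 *
          (if i.1 ≤ j.1 then
              ∏ m ∈ Finset.Icc (i.1 + 1) j.1, (1 - t m * (z (i.1 + 1))⁻¹)
            else
              ∏ m ∈ Finset.Icc (j.1 + 1) i.1, (1 - t m * (z (i.1 + 1))⁻¹)⁻¹)) =
        ∏ p ∈ Finset.univ.filter (fun p : Fin lgth × Fin lgth => p.1 < p.2),
          (z (p.2.1 + 1) - z (p.1.1 + 1)) * z (p.2.1 + 1) /
            (z (p.2.1 + 1) - t (p.1.1 + 1)) := by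
  have hdet := det_deformed_eq_prod_div lgth z t hz hzt
  refine ⟨hdet, hdet.trans (Finset.prod_congr rfl fun p hp => ?_)⟩
  have hlt : p.1.1 < p.2.1 := (Finset.mem_filter.1 hp).2
  have hz' := hz (p.2.1 + 1) (by omega) (by omega)
  rw [← mul_div_mul_right _ (1 - t (p.1.1 + 1) * (z (p.2.1 + 1))⁻¹) hz',
    sub_mul 1, one_mul, inv_mul_cancel_right₀ hz']

end
end

section
/- Let λ be a partition with at most n parts, x = (x_1,…,x_n), t = (t_1,…,t_{n−1}). Then the refined Grothendieck polynomial satisfies the Jacobi–Trudi formulas G_λ(x;t) = det[ Σ_{k=0}^{∞} e_{k − λ_i + i − j}(−t_1,…,−t_{i−1}) · h_k(x) ]_{i,j=1}^{n} = det[ Σ_{k=0}^{∞} e_k(−t_1,…,−t_{i−1}) · h_{k + λ_i − i + j}(x) ]_{i,j=1}^{n}, where h_k(x) is the complete homogeneous symmetric polynomial in x_1,…,x_n (h_k = 0 for k < 0) and e_m(−t_1,…,−t_{i−1}) is the elementary symmetric polynomial of degree m in the negated variables −t_1,…,−t_{i−1} (e_m vanishes for m < 0 and for m > i−1, so each inner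 sum is finite). -/
open scoped Classical

noncomputable section

variable {R : Type*} [CommRing R]

/-- A semistandard set-valued tableau of shape `lam` with entries in `{1,…,n}`
(a value `v : Fin n` encodes the letter `v+1`): every box carries a nonempty
finite set, for horizontally adjacent boxes `max A ≤ min B`, and for vertically
adjacent boxes `max A < min C`. -/
def IsSVT (ℓ n : ℕ) (lam : ℕ → ℕ) (T : YBox ℓ lam → Finset (Fin n)) : Prop :=
  (∀ b : YBox ℓ lam, (T b).Nonempty) ∧
  (∀ (r : Fin ℓ) (c c' : Fin (lam r.1)), (c : ℕ) < (c' : ℕ) →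
    ∀ a ∈ T ⟨r, c⟩, ∀ a' ∈ T ⟨r, c'⟩, a ≤ a') ∧
  (∀ (r r' : Fin ℓ) (c : Fin (lam r.1)) (c' : Fin (lam r'.1)),
    (r : ℕ) < (r' : ℕ) → (c : ℕ) = (c' : ℕ) →
    ∀ a ∈ T ⟨r, c⟩, ∀ a' ∈ T ⟨r', c'⟩, a < a')

/-- The refined Grothendieck polynomial
`G_λ(x;t) = Σ_T (-1)^{|e(T)|} t^{e(T)} x^T`, summed over semistandard
set-valued tableaux of shape `lam` with entries in `{1,…,n}`, where the excess
`e_i(T)` of row `i` is the number of extra entries in row `i`. -/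
def grothendieck (ℓ n : ℕ) (lam : ℕ → ℕ) (x t : ℕ → R) : R :=
  ∑ T ∈ Finset.univ.filter (IsSVT ℓ n lam),
    (-1 : R) ^ (∑ b : YBox ℓ lam, ((T b).card - 1)) *
      (∏ b : YBox ℓ lam, t (b.1.1 + 1) ^ ((T b).card - 1)) *
      ∏ b : YBox ℓ lam, ∏ v ∈ T b, x (v.1 + 1)


theorem hL_zero (L : List R) : hL 0 L = 1 := by
  have : (Finset.univ.filter (fun f : Fin 0 → Fin L.length => Monotone f)) = Finset.univ :=
    Finset.filter_true_of_mem fun f _ i => i.elim0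
  rw [hL, this]
  simp

theorem eL_zero (L : List R) : eL 0 L = 1 := by
  have : (Finset.univ.filter (fun f : Fin 0 → Fin L.length => StrictMono f)) = Finset.univ :=
    Finset.filter_true_of_mem fun f _ i => i.elim0
  rw [eL, this]
  simp

theorem hL_succ_nil (k : ℕ) : hL (k + 1) ([] : List R) = 0 :=
  Finset.sum_eq_zero fun f _ => (f 0).elim0

theorem eL_eq_zero_of_length_lt {k : ℕ} {L : List R} (h : L.length < k) : eL k L = 0 := by
  refine Finset.sum_eq_zero fun f hf => ?_
  have := Fintype.card_le_of_injective f (Finset.mem_filter.1 hf).2.injective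
  simp at this
  omega

theorem hL_succ_cons (k : ℕ) (a : R) (L : List R) :
    hL (k + 1) (a :: L) = a * hL k (a :: L) + hL (k + 1) L := by
  unfold hL
  rw [← Finset.sum_filter_add_sum_filter_not _ (fun f => f 0 = (0 : Fin (L.length + 1)))]
  congr 1
  · rw [Finset.mul_sum]
    refine Finset.sum_nbij' (fun f => Fin.tail f)
      (fun g => Fin.cons (0 : Fin (L.length + 1)) g) ?_ ?_ ?_ ?_ ?_
    · intro f hf
      simp only [Finset.mem_filter, Finset.mem_univ, true_and] at hf ⊢
      exact fun i j hij => hf.1 (Fin.succ_le_succ_iff.2 hij)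
    · intro g hg
      simp only [Finset.mem_filter, Finset.mem_univ, true_and] at hg ⊢
      refine ⟨fun i j hij => ?_, rfl⟩
      induction i using Fin.cases with
      | zero => exact Fin.zero_le (n := L.length + 1) _
      | succ i =>
        induction j using Fin.cases with
        | zero => exact absurd hij (by simp)
        | succ j => exact hg (Fin.succ_le_succ_iff.1 hij)
    · intro f hf
      simp only [Finset.mem_filter, Finset.mem_univ, true_and] at hf
      conv_rhs => rw [← Fin.cons_self_tail f, hf.2]
    · intro g _
      rfl
    · intro f hf
      simp only [Finset.mem_filter, Finset.mem_univ, true_and] at hf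
      rw [Fin.prod_univ_succ, hf.2]
      rfl
  · symm
    refine Finset.sum_nbij (fun g i => (g i).succ) ?_ ?_ ?_ ?_
    · intro g hg
      simp only [Finset.mem_filter, Finset.mem_univ, true_and] at hg ⊢
      exact ⟨fun i j hij => Fin.succ_le_succ_iff.2 (hg hij), Fin.succ_ne_zero _⟩
    · intro g _ g' _ h
      funext i
      exact Fin.succ_injective _ (congrFun h i)
    · intro f hf
      simp only [Finset.coe_filter, Finset.mem_filter, Finset.mem_univ, true_and,
        Set.mem_ofPred_eq] at hf
      have hne : ∀ i, f i ≠ (0 : Fin (L.length + 1)) := fun i hi =>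
        hf.2 (Fin.le_zero_iff.1 (hi ▸ hf.1 (Fin.zero_le i)))
      choose g hg using fun i => Fin.exists_succ_eq.2 (hne i)
      refine ⟨g, ?_, funext hg⟩
      simp only [Finset.coe_filter, Finset.mem_univ, true_and, Set.mem_ofPred_eq]
      intro i j hij
      have := hf.1 hij
      rw [← hg i, ← hg j] at this
      exact Fin.succ_le_succ_iff.1 this
    · intro g _
      rfl

theorem eL_succ_cons (k : ℕ) (a : R) (L : List R) :
    eL (k + 1) (a :: L) = a * eL k L + eL (k + 1) L := by
  unfold eL
  rw [← Finset.sum_filter_add_sum_filter_not _ (fun f => f 0 = (0 : Fin (L.length + 1)))]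
  congr 1
  · rw [Finset.mul_sum]
    symm
    refine Finset.sum_nbij
      (fun g => Fin.cons (0 : Fin (L.length + 1)) (fun i => (g i).succ)) ?_ ?_ ?_ ?_
    · intro g hg
      simp only [Finset.mem_filter, Finset.mem_univ, true_and] at hg ⊢
      refine ⟨fun i j hij => ?_, rfl⟩
      induction j using Fin.cases with
      | zero => exact absurd hij (by simp)
      | succ j =>
        induction i using Fin.cases with
        | zero => exact Fin.succ_pos (n := L.length) _
        | succ i => exact Fin.succ_lt_succ_iff.2 (hg (Fin.succ_lt_succ_iff.1 hij))
    · intro g _ g' _ h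
      funext i
      exact Fin.succ_injective _ (congrFun h i.succ)
    · intro f hf
      simp only [Finset.coe_filter, Finset.mem_filter, Finset.mem_univ, true_and,
        Set.mem_ofPred_eq] at hf
      have hne : ∀ i : Fin k, f i.succ ≠ (0 : Fin (L.length + 1)) := fun i hi => by
        have := hf.1 (Fin.succ_pos i)
        rw [hi, hf.2] at this
        exact lt_irrefl _ this
      choose g hg using fun i => Fin.exists_succ_eq.2 (hne i)
      refine ⟨g, ?_, ?_⟩
      · simp only [Finset.coe_filter, Finset.mem_univ, true_and, Set.mem_ofPred_eq]
        intro i j hij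
        have := hf.1 (Fin.succ_lt_succ_iff.2 hij)
        rw [← hg i, ← hg j] at this
        exact Fin.succ_lt_succ_iff.1 this
      · funext i
        induction i using Fin.cases with
        | zero => exact hf.2.symm
        | succ i => exact hg i
    · intro g _
      rw [Fin.prod_univ_succ]
      rfl
  · symm
    refine Finset.sum_nbij (fun g i => (g i).succ) ?_ ?_ ?_ ?_
    · intro g hg
      simp only [Finset.mem_filter, Finset.mem_univ, true_and] at hg ⊢
      exact ⟨fun i j hij => Fin.succ_lt_succ_iff.2 (hg hij), Fin.succ_ne_zero _⟩
    · intro g _ g' _ h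
      funext i
      exact Fin.succ_injective _ (congrFun h i)
    · intro f hf
      simp only [Finset.coe_filter, Finset.mem_filter, Finset.mem_univ, true_and,
        Set.mem_ofPred_eq] at hf
      have hne : ∀ i, f i ≠ (0 : Fin (L.length + 1)) := fun i hi =>
        hf.2 (Fin.le_zero_iff.1 (hi ▸ hf.1.monotone (Fin.zero_le i)))
      choose g hg using fun i => Fin.exists_succ_eq.2 (hne i)
      refine ⟨g, ?_, funext hg⟩
      simp only [Finset.coe_filter, Finset.mem_univ, true_and, Set.mem_ofPred_eq]
      intro i j hij
      have := hf.1 hij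
      rw [← hg i, ← hg j] at this
      exact Fin.succ_lt_succ_iff.1 this
    · intro g _
      rfl

/-- The generating function `Σ_k h_k(L) X^k`. -/
def hSeries (L : List R) : PowerSeries R := PowerSeries.mk fun k => hL k L

theorem hSeries_cons (a : R) (L : List R) :
    hSeries (a :: L) * (1 - PowerSeries.C a * PowerSeries.X) = hSeries L := by
  ext k
  rw [mul_sub, mul_one, map_sub, mul_left_comm, PowerSeries.coeff_C_mul]
  cases k with
  | zero => simp [hSeries, hL_zero]
  | succ k =>
    rw [PowerSeries.coeff_succ_mul_X]
    simp [hSeries, hL_succ_cons]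

theorem hSeries_mul_prod (L : List R) :
    hSeries L * (L.map fun a => 1 - PowerSeries.C a * PowerSeries.X).prod = 1 := by
  induction L with
  | nil =>
    ext k
    cases k with
    | zero => simp [hSeries, hL_zero]
    | succ k => simp [hSeries, hL_succ_nil, PowerSeries.coeff_one]
  | cons a L ih => rw [List.map_cons, List.prod_cons, ← mul_assoc, hSeries_cons, ih]

/-- The coefficient of a power series at an integer exponent. -/
def coeffInt (d : ℤ) (F : PowerSeries R) : R :=
  if 0 ≤ d then PowerSeries.coeff d.toNat F else 0

theorem hInt_eq_coeffInt (d : ℤ) (L : List R) : hInt d L = coeffInt d (hSeries L) := by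
  simp [hInt, coeffInt, hSeries]

theorem coeffInt_X_mul (d : ℤ) (F : PowerSeries R) :
    coeffInt d (PowerSeries.X * F) = coeffInt (d - 1) F := by
  rcases lt_trichotomy d 0 with h | rfl | h
  · rw [coeffInt, coeffInt, if_neg (by omega), if_neg (by omega)]
  · simp [coeffInt]
  · rw [coeffInt, coeffInt, if_pos (by omega), if_pos (by omega)]
    obtain ⟨m, rfl⟩ : ∃ m : ℕ, d = m + 1 := ⟨(d - 1).toNat, by omega⟩
    rw [show ((m : ℤ) + 1).toNat = m + 1 by omega, show ((m : ℤ) + 1 - 1).toNat = m by omega,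
      PowerSeries.coeff_succ_X_mul]

theorem sum_eL_mul_coeffInt (L : List R) (F : PowerSeries R) (d : ℤ) :
    ∑ k ∈ Finset.range (L.length + 1), eL k L * coeffInt (k + d - L.length) F =
      coeffInt d ((L.map fun a => PowerSeries.X + PowerSeries.C a).prod * F) := by
  induction L generalizing d with
  | nil => simp [eL_zero]
  | cons a L ih =>
    have hadd : coeffInt d (((a :: L).map fun a => PowerSeries.X + PowerSeries.C a).prod * F) =
        coeffInt (d - 1) ((L.map fun a => PowerSeries.X + PowerSeries.C a).prod * F) +
          a * coeffInt d ((L.map fun a => PowerSeries.X + PowerSeries.C a).prod * F) := by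
      rw [List.map_cons, List.prod_cons, mul_assoc, ← coeffInt_X_mul, add_mul]
      simp only [coeffInt]
      split_ifs <;> simp
    rw [hadd, ← ih, ← ih, List.length_cons, Finset.sum_range_succ', Finset.mul_sum]
    simp only [eL_succ_cons, add_mul, Finset.sum_add_distrib, eL_zero]
    rw [add_assoc, add_comm]
    congr 1
    · rw [Finset.sum_range_succ, eL_eq_zero_of_length_lt (Nat.lt_succ_self _), zero_mul, add_zero,
        Finset.sum_range_succ', eL_zero]
      congr 1
      · refine Finset.sum_congr rfl fun k _ => ?_
        congr 2; push_cast; ring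
      · congr 2; push_cast; ring
    · refine Finset.sum_congr rfl fun k _ => ?_
      rw [mul_assoc]
      congr 3; push_cast; ring

theorem finsum_eL_mul_hInt (L M : List R) (d : ℤ) :
    ∑ᶠ k : ℕ, eL k L * hInt (k + d - L.length) M =
      coeffInt d ((L.map fun a => PowerSeries.X + PowerSeries.C a).prod * hSeries M) := by
  rw [← sum_eL_mul_coeffInt]
  simp only [hInt_eq_coeffInt]
  refine finsum_eq_sum_of_support_subset _ fun k hk => ?_
  rw [Finset.coe_range, Set.mem_Iio]
  by_contra h
  exact hk (by simp only [eL_eq_zero_of_length_lt (show L.length < k by omega), zero_mul])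

theorem finsum_natCast_eq {f : ℤ → R} (hf : ∀ z < 0, f z = 0) :
    ∑ᶠ k : ℕ, f k = ∑ᶠ z : ℤ, f z := by
  rw [← finsum_mem_range (f := f) Nat.cast_injective, ← finsum_mem_univ f]
  refine finsum_mem_inter_support_eq' _ _ _ fun z hz => iff_of_true ⟨z.toNat, ?_⟩ trivial
  exact Int.toNat_of_nonneg (not_lt.1 fun h => hz (hf z h))

theorem finsum_eInt_mul_hL (L M : List R) (d : ℤ) :
    ∑ᶠ k : ℕ, eInt (k - d) L * hL k M = ∑ᶠ k : ℕ, eL k L * hInt (k + d) M := by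
  have h1 := finsum_natCast_eq (f := fun z => eInt (z - d) L * hInt z M)
    (fun z hz => by simp [hInt, not_le.2 hz])
  have h2 := finsum_natCast_eq (f := fun z => eInt z L * hInt (z + d) M)
    (fun z hz => by simp [eInt, not_le.2 hz])
  have h3 := finsum_comp_equiv (Equiv.addRight d) (f := fun z => eInt (z - d) L * hInt z M)
  simp only [Equiv.coe_addRight, add_sub_cancel_right] at h3
  simpa [eInt, hInt] using h1.trans (h3.symm.trans h2.symm)

/-- The Jacobi–Trudi matrix, its entries written as coefficients of the generating function
`∏_{m<i} (X - s_m) * Σ_k h_k(y) X^k`. -/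
def jacobiTrudi (n : ℕ) (lam : ℕ → ℕ) (y s : ℕ → R) : Matrix (Fin n) (Fin n) R :=
  Matrix.of fun i j => PowerSeries.coeff (lam i + j)
    ((∏ m ∈ Finset.range i, (PowerSeries.X - PowerSeries.C (s m))) *
      hSeries ((List.range n).map y))

/-- The numerator matrix of the bialternant formula. -/
def alternant (n : ℕ) (lam : ℕ → ℕ) (y s : ℕ → R) : Matrix (Fin n) (Fin n) R :=
  Matrix.of fun i k => y k ^ (lam i + (n - 1 - i)) * ∏ m ∈ Finset.range i, (1 - s m * y k)

/-- The matrix of signed elementary symmetric polynomials with one variable omitted. -/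
def omitMatrix (n : ℕ) (y : ℕ → R) : Matrix (Fin n) (Fin n) R :=
  Matrix.of fun j k => PowerSeries.coeff (n - 1 - j)
    (∏ l ∈ (Finset.range n).erase k, (1 - PowerSeries.C (y l) * PowerSeries.X))

theorem hSeries_range_mul_prod (n : ℕ) (y : ℕ → R) :
    hSeries ((List.range n).map y) *
      ∏ l ∈ Finset.range n, (1 - PowerSeries.C (y l) * PowerSeries.X) = 1 := by
  have := hSeries_mul_prod ((List.range n).map y)
  rwa [List.map_map] at this

theorem geom_mul_one_sub (a : R) :
    (PowerSeries.mk fun m => a ^ m) * (1 - PowerSeries.C a * PowerSeries.X) = 1 := by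
  ext k
  rw [mul_sub, mul_one, map_sub, mul_left_comm, PowerSeries.coeff_C_mul]
  cases k with
  | zero => simp
  | succ k =>
    rw [PowerSeries.coeff_succ_mul_X]
    simp [PowerSeries.coeff_one, pow_succ']

theorem hSeries_mul_prod_erase {n k : ℕ} (hk : k < n) (y : ℕ → R) :
    hSeries ((List.range n).map y) *
      ∏ l ∈ (Finset.range n).erase k, (1 - PowerSeries.C (y l) * PowerSeries.X) =
      PowerSeries.mk fun m => y k ^ m := by
  have h := hSeries_range_mul_prod n y
  rw [← Finset.mul_prod_erase _ _ (Finset.mem_range.2 hk), mul_left_comm, mul_comm] at h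
  exact left_inv_eq_right_inv h (by rw [mul_comm]; exact geom_mul_one_sub (y k))

theorem coeff_prod_one_sub_eq_zero {ι : Type*} (S : Finset ι) (y : ι → R) {m : ℕ}
    (hm : S.card < m) :
    PowerSeries.coeff m (∏ l ∈ S, (1 - PowerSeries.C (y l) * PowerSeries.X)) = 0 := by
  induction S using Finset.induction_on generalizing m with
  | empty => simp [PowerSeries.coeff_one] at hm ⊢; omega
  | insert a S ha ih =>
    rw [Finset.card_insert_of_notMem ha] at hm
    obtain ⟨m, rfl⟩ : ∃ k, m = k + 1 := ⟨m - 1, by omega⟩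
    rw [Finset.prod_insert ha, sub_mul, one_mul, map_sub, ih (by omega), mul_assoc,
      PowerSeries.coeff_C_mul, PowerSeries.coeff_succ_X_mul, ih (by omega), mul_zero, sub_zero]

theorem coeff_prod_X_sub_mul_geom (s : ℕ → R) (y : R) (i a : ℕ) :
    PowerSeries.coeff (a + i)
      ((∏ m ∈ Finset.range i, (PowerSeries.X - PowerSeries.C (s m))) *
        PowerSeries.mk fun m => y ^ m) =
      y ^ a * ∏ m ∈ Finset.range i, (1 - s m * y) := by
  induction i generalizing a with
  | zero => simp
  | succ i ih =>
    rw [Finset.prod_range_succ, Finset.prod_range_succ, mul_right_comm, mul_comm _ (_ - _), sub_mul,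
      map_sub, ← add_assoc, PowerSeries.coeff_succ_X_mul, PowerSeries.coeff_C_mul, ih,
      add_right_comm, ih]
    ring

theorem jacobiTrudi_mul_omitMatrix (n : ℕ) (lam : ℕ → ℕ) (y s : ℕ → R) :
    jacobiTrudi n lam y s * omitMatrix n y = alternant n lam y s := by
  ext i k
  simp only [Matrix.mul_apply, jacobiTrudi, omitMatrix, alternant, Matrix.of_apply]
  set E := ∏ m ∈ Finset.range i, (PowerSeries.X - PowerSeries.C (s m)) with hE
  set P := ∏ l ∈ (Finset.range n).erase k, (1 - PowerSeries.C (y l) * PowerSeries.X) with hP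
  set F := E * hSeries ((List.range n).map y) with hF
  have hi := i.2
  have hPF : P * F = E * PowerSeries.mk fun m => y k ^ m := by
    rw [← hSeries_mul_prod_erase k.2, hF, mul_comm, mul_assoc]
  rw [← coeff_prod_X_sub_mul_geom, ← hE, ← hPF,
    show lam i + (n - 1 - i) + i = lam i + (n - 1) by omega, PowerSeries.coeff_mul,
    Finset.Nat.sum_antidiagonal_eq_sum_range_succ
      (fun a b => PowerSeries.coeff a P * PowerSeries.coeff b F),
    ← Finset.sum_subset (Finset.range_mono (show n ≤ lam i + (n - 1) + 1 by omega)),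
    ← Finset.sum_range_reflect, Finset.sum_range]
  · refine Finset.sum_congr rfl fun j _ => ?_
    rw [mul_comm]
    congr 3
    have := j.2
    omega
  · intro m _ hm
    rw [Finset.mem_range] at hm
    rw [hP, coeff_prod_one_sub_eq_zero, zero_mul]
    rw [Finset.card_erase_of_mem (Finset.mem_range.2 k.2), Finset.card_range]
    omega

theorem det_jacobiTrudi_zero (n : ℕ) (y : ℕ → R) :
    (jacobiTrudi n (fun _ => 0) y fun _ => 0).det = 1 := by
  rw [Matrix.det_of_isUpperTriangular]
  · refine Finset.prod_eq_one fun i _ => ?_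
    simp [jacobiTrudi, PowerSeries.coeff_X_pow_mul', hSeries, hL_zero]
  · intro i j hij
    have : ¬ i ≤ j := not_le.2 hij
    simp [jacobiTrudi, PowerSeries.coeff_X_pow_mul', this]

theorem det_omitMatrix (n : ℕ) (y : ℕ → R) :
    (omitMatrix n y).det = (alternant n (fun _ => 0) y fun _ => 0).det := by
  rw [← jacobiTrudi_mul_omitMatrix, Matrix.det_mul, det_jacobiTrudi_zero, one_mul]

/-- Pairs `(ν, ε)` with `b ≤ ν ≤ ν + ε ≤ a` and `ε ≤ 1`: in a row of length `a` above a row of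
length `b`, `ν` counts the boxes without the largest letter and `ν + ε` those with a smaller
letter. -/
def rowChoices (b a : ℕ) : Finset (ℕ × ℕ) :=
  (Finset.Icc b a ×ˢ Finset.range 2).filter fun p => p.1 + p.2 ≤ a

theorem mem_rowChoices {b a : ℕ} {p : ℕ × ℕ} :
    p ∈ rowChoices b a ↔ b ≤ p.1 ∧ p.2 < 2 ∧ p.1 + p.2 ≤ a := by
  simp only [rowChoices, Finset.mem_filter, Finset.mem_product, Finset.mem_Icc, Finset.mem_range]
  omega

theorem sub_mul_sum_rowChoices {b a : ℕ} (hba : b ≤ a) (s y z : R) :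
    (y - z) * ∑ p ∈ rowChoices b a, z ^ (a - p.1) * (-s) ^ p.2 * y ^ (p.1 + p.2) =
      (1 - s * z) * y ^ (a + 1) - z ^ (a - b + 1) * ((1 - s * y) * y ^ b) := by
  obtain ⟨d, rfl⟩ := Nat.exists_eq_add_of_le hba
  have hsum : ∀ d, ∑ p ∈ rowChoices b (b + d),
      z ^ (b + d - p.1) * (-s) ^ p.2 * y ^ (p.1 + p.2) =
      ∑ q ∈ Finset.range (d + 1), z ^ (d - q) * y ^ (b + q) -
        s * ∑ q ∈ Finset.range d, z ^ (d - q) * y ^ (b + q + 1) := by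
    intro d
    rw [rowChoices, Finset.sum_filter, Finset.sum_product, ← Finset.Ico_add_one_right_eq_Icc,
      Finset.sum_Ico_eq_sum_range, show b + d + 1 - b = d + 1 by omega]
    simp only [Finset.sum_range_succ _ 1, Finset.sum_range_one, Finset.sum_add_distrib]
    rw [sub_eq_add_neg]
    congr 1
    · refine Finset.sum_congr rfl fun q hq => ?_
      rw [Finset.mem_range] at hq
      rw [if_pos (by omega), show b + d - (b + q) = d - q by omega]
      ring
    · rw [Finset.sum_range_succ, if_neg (by omega), add_zero, Finset.mul_sum,
        ← Finset.sum_neg_distrib]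
      refine Finset.sum_congr rfl fun q hq => ?_
      rw [Finset.mem_range] at hq
      rw [if_pos (by omega), show b + d - (b + q) = d - q by omega]
      ring
  rw [hsum, show b + d - b = d by omega]
  clear hsum hba
  induction d with
  | zero => simp; ring
  | succ d ih =>
    have e1 : ∑ q ∈ Finset.range (d + 1), z ^ (d + 1 - q) * y ^ (b + q) =
        z * ∑ q ∈ Finset.range (d + 1), z ^ (d - q) * y ^ (b + q) := by
      rw [Finset.mul_sum]
      refine Finset.sum_congr rfl fun q hq => ?_
      rw [Finset.mem_range] at hq
      rw [show d + 1 - q = d - q + 1 by omega]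
      ring
    have e2 : ∑ q ∈ Finset.range d, z ^ (d + 1 - q) * y ^ (b + q + 1) =
        z * ∑ q ∈ Finset.range d, z ^ (d - q) * y ^ (b + q + 1) := by
      rw [Finset.mul_sum]
      refine Finset.sum_congr rfl fun q hq => ?_
      rw [Finset.mem_range] at hq
      rw [show d + 1 - q = d - q + 1 by omega]
      ring
    rw [Finset.sum_range_succ, e1, Finset.sum_range_succ (n := d)
      (f := fun q => z ^ (d + 1 - q) * y ^ (b + q + 1)), e2, Nat.sub_self,
      show d + 1 - d = 1 by omega]
    linear_combination z * ih

theorem det_sum_rows {n : ℕ} {ι : Type*} (S : Fin n → Finset ι) (w : Fin n → ι → R)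
    (f : Fin n → ι → Fin n → R) :
    (Matrix.of fun i k => ∑ p ∈ S i, w i p * f i p k).det =
      ∑ p ∈ Fintype.piFinset S, (∏ i, w i (p i)) * (Matrix.of fun i k => f i (p i) k).det := by
  have h := (Matrix.detRowAlternating (n := Fin n) (R := R)).toMultilinearMap.map_sum_finset
    (fun i p => w i p • f i p) S
  have e : (Matrix.of fun i k => ∑ p ∈ S i, w i p * f i p k) =
      fun i => ∑ p ∈ S i, w i p • f i p := by
    ext i k
    simp [Finset.sum_apply]
  rw [e]
  refine h.trans (Finset.sum_congr rfl fun p _ => ?_)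
  exact (Matrix.detRowAlternating (n := Fin n) (R := R)).toMultilinearMap.map_smul_univ
    (fun i => w i (p i)) (fun i => f i (p i))

theorem det_eq_mul_of_last_column {n : ℕ} (B : Matrix (Fin (n + 1)) (Fin (n + 1)) R)
    (h : ∀ i : Fin n, B i.castSucc (Fin.last n) = 0) :
    B.det = B (Fin.last n) (Fin.last n) *
      (B.submatrix Fin.castSucc Fin.castSucc).det := by
  rw [Matrix.det_succ_column B (Fin.last n), Fin.sum_univ_castSucc]
  simp [h, ← two_mul, Fin.succAbove_last]

/-- The upper bidiagonal matrix that clears the last column of the alternant. -/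
def clearingMatrix (n : ℕ) (lam : ℕ → ℕ) (z : R) (s : ℕ → R) :
    Matrix (Fin (n + 1)) (Fin (n + 1)) R :=
  Matrix.of fun i j =>
    if i = j then (if (i : ℕ) < n then 1 - s i * z else 1)
    else if (i : ℕ) + 1 = j then -z ^ (lam i - lam (i + 1) + 1) else 0

theorem det_clearingMatrix (n : ℕ) (lam : ℕ → ℕ) (z : R) (s : ℕ → R) :
    (clearingMatrix n lam z s).det = ∏ i ∈ Finset.range n, (1 - s i * z) := by
  rw [Matrix.det_of_isUpperTriangular, Fin.prod_univ_castSucc, Finset.prod_range]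
  · simp [clearingMatrix]
  · intro i j hij
    have : (j : ℕ) < i := hij
    have hne : i ≠ j := by rintro rfl; omega
    have hne' : ¬ (i : ℕ) + 1 = j := by omega
    simp [clearingMatrix, hne, hne']

theorem clearingMatrix_mul_castSucc (n : ℕ) (lam : ℕ → ℕ) (z : R) (s : ℕ → R)
    (F : Matrix (Fin (n + 1)) (Fin (n + 1)) R) (i : Fin n) (k : Fin (n + 1)) :
    (clearingMatrix n lam z s * F) i.castSucc k =
      (1 - s i * z) * F i.castSucc k - z ^ (lam i - lam (i + 1) + 1) * F i.succ k := by
  have hne : i.castSucc ≠ i.succ := Fin.castSucc_lt_succ.ne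
  rw [Matrix.mul_apply, Fintype.sum_eq_add i.castSucc i.succ hne]
  · simp [clearingMatrix, hne, sub_eq_add_neg]
  · rintro j ⟨h1, h2⟩
    have h3 : ¬ (i : ℕ) + 1 = j := fun h => h2 (Fin.ext h.symm)
    simp [clearingMatrix, h1.symm, h3]

theorem clearingMatrix_mul_last (n : ℕ) (lam : ℕ → ℕ) (z : R) (s : ℕ → R)
    (F : Matrix (Fin (n + 1)) (Fin (n + 1)) R) (k : Fin (n + 1)) :
    (clearingMatrix n lam z s * F) (Fin.last n) k = F (Fin.last n) k := by
  rw [Matrix.mul_apply, Fintype.sum_eq_single (Fin.last n)]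
  · simp [clearingMatrix]
  · intro j hj
    have h3 : ¬ n + 1 = (j : ℕ) := by have := j.2; omega
    simp [clearingMatrix, hj.symm, h3]

theorem clearingMatrix_mul_alternant {n : ℕ} {lam : ℕ → ℕ}
    (hlam : ∀ i < n, lam (i + 1) ≤ lam i) (y s : ℕ → R) (i : Fin n) (k : Fin (n + 1)) :
    (clearingMatrix n lam (y n) s * alternant (n + 1) lam y s) i.castSucc k =
      (y k - y n) * ∑ p ∈ rowChoices (lam (i + 1)) (lam i),
        (y n ^ (lam i - p.1) * (-s i) ^ p.2) *
          (y k ^ (p.1 + p.2 + (n - 1 - i)) * ∏ m ∈ Finset.range i, (1 - s m * y k)) := by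
  have hi := i.2
  have h := sub_mul_sum_rowChoices (hlam i i.2) (s i) (y k) (y n)
  have e : ∑ p ∈ rowChoices (lam (i + 1)) (lam i),
        (y n ^ (lam i - p.1) * (-s i) ^ p.2) *
          (y k ^ (p.1 + p.2 + (n - 1 - i)) * ∏ m ∈ Finset.range i, (1 - s m * y k)) =
      (∑ p ∈ rowChoices (lam (i + 1)) (lam i),
        y n ^ (lam i - p.1) * (-s i) ^ p.2 * y k ^ (p.1 + p.2)) *
          (y k ^ (n - 1 - i) * ∏ m ∈ Finset.range i, (1 - s m * y k)) := by
    rw [Finset.sum_mul]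
    exact Finset.sum_congr rfl fun p _ => by ring
  rw [e, ← mul_assoc, h, clearingMatrix_mul_castSucc]
  simp only [alternant, Matrix.of_apply, Fin.val_castSucc, Fin.val_succ, Finset.prod_range_succ]
  rw [show n + 1 - 1 - (i : ℕ) = (n - 1 - i) + 1 by omega,
    show n + 1 - 1 - ((i : ℕ) + 1) = n - 1 - i by omega]
  ring

theorem det_alternant_succ {n : ℕ} {lam : ℕ → ℕ}
    (hlam : ∀ i < n, lam (i + 1) ≤ lam i) (y s : ℕ → R) :
    (∏ i ∈ Finset.range n, (1 - s i * y n)) * (alternant (n + 1) lam y s).det =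
      (∏ i ∈ Finset.range n, (1 - s i * y n)) *
        ((∏ k ∈ Finset.range n, (y k - y n)) * (y n ^ lam n *
          ∑ p ∈ Fintype.piFinset fun i : Fin n => rowChoices (lam (i + 1)) (lam i),
            (∏ i : Fin n, y n ^ (lam i - (p i).1) * (-s i) ^ (p i).2) *
              (alternant n (extendFin n fun i => (p i).1 + (p i).2) y s).det)) := by
  rw [← det_clearingMatrix n lam, ← Matrix.det_mul, det_eq_mul_of_last_column,
    clearingMatrix_mul_last, det_clearingMatrix]
  · have hsub : (clearingMatrix n lam (y n) s * alternant (n + 1) lam y s).submatrix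
        Fin.castSucc Fin.castSucc = Matrix.of fun (i k : Fin n) => (y k - y n) *
          (Matrix.of fun (i k : Fin n) => ∑ p ∈ rowChoices (lam (i + 1)) (lam i),
        (y n ^ (lam i - p.1) * (-s i) ^ p.2) *
          (y k ^ (p.1 + p.2 + (n - 1 - i)) *
            ∏ m ∈ Finset.range i, (1 - s m * y k))) i k := by
      ext i k
      rw [Matrix.submatrix_apply, clearingMatrix_mul_alternant hlam]
      rfl
    rw [hsub, Matrix.det_mul_row, det_sum_rows, Finset.prod_range (fun k => y k - y n)]
    have halt : ∀ p : Fin n → ℕ × ℕ,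
        (Matrix.of fun i k : Fin n => y k ^ ((p i).1 + (p i).2 + (n - 1 - i)) *
            ∏ m ∈ Finset.range i, (1 - s m * y k)) =
          alternant n (extendFin n fun i => (p i).1 + (p i).2) y s := by
      intro p
      ext i k
      simp [alternant, extendFin]
    simp only [halt]
    simp only [alternant, Matrix.of_apply, Fin.val_last, add_tsub_cancel_right, Nat.sub_self,
      add_zero]
    ring
  · intro i
    rw [clearingMatrix_mul_alternant hlam]
    simp

/-- A semistandard set-valued tableau of shape `lam` with `n` rows and letters `0, …, n - 1`, as a
filling of the whole quadrant that is empty outside of the shape. -/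
structure IsQuadrantSVT (n : ℕ) (lam : ℕ → ℕ) (T : ℕ → ℕ → Finset ℕ) : Prop where
  nonempty_iff : ∀ r c, (T r c).Nonempty ↔ r < n ∧ c < lam r
  lt : ∀ r c, ∀ a ∈ T r c, a < n
  row : ∀ r c c', c < c' → ∀ a ∈ T r c, ∀ a' ∈ T r c', a ≤ a'
  col : ∀ r r' c, r < r' → ∀ a ∈ T r c, ∀ a' ∈ T r' c, a < a'

/-- Extend a filling of a Young diagram to the quadrant by empty sets. -/
def extendFilling (n : ℕ) (lam : ℕ → ℕ) (T : YBox n lam → Finset (Fin n)) :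
    ℕ → ℕ → Finset ℕ :=
  fun r c => if h : r < n ∧ c < lam r then
    (T ⟨⟨r, h.1⟩, ⟨c, h.2⟩⟩).map Fin.valEmbedding else ∅

theorem extendFilling_apply {n : ℕ} {lam : ℕ → ℕ} (T : YBox n lam → Finset (Fin n))
    (r : Fin n) (c : Fin (lam r)) :
    extendFilling n lam T r c = (T ⟨r, c⟩).map Fin.valEmbedding :=
  dif_pos ⟨r.2, c.2⟩

theorem exists_of_mem_extendFilling {n : ℕ} {lam : ℕ → ℕ} {T : YBox n lam → Finset (Fin n)}
    {r c a : ℕ} (ha : a ∈ extendFilling n lam T r c) :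
    ∃ (hr : r < n) (hc : c < lam r) (ha : a < n), ⟨a, ha⟩ ∈ T ⟨⟨r, hr⟩, ⟨c, hc⟩⟩ := by
  unfold extendFilling at ha
  split_ifs at ha with h
  · obtain ⟨b, hb, rfl⟩ := Finset.mem_map.1 ha
    exact ⟨h.1, h.2, b.2, hb⟩
  · simp at ha

theorem extendFilling_injective (n : ℕ) (lam : ℕ → ℕ) :
    Function.Injective (extendFilling n lam) := by
  rintro T T' h
  funext ⟨r, c⟩
  have := congrFun (congrFun h r) c
  rw [extendFilling_apply, extendFilling_apply] at this
  exact Finset.map_injective _ this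

/-- The finite set of set-valued tableaux of shape `lam`, as fillings of the quadrant. -/
def quadrantSVT (n : ℕ) (lam : ℕ → ℕ) : Finset (ℕ → ℕ → Finset ℕ) :=
  (Finset.univ.filter (IsSVT n n lam)).image (extendFilling n lam)

theorem mem_quadrantSVT {n : ℕ} {lam : ℕ → ℕ} {T : ℕ → ℕ → Finset ℕ} :
    T ∈ quadrantSVT n lam ↔ IsQuadrantSVT n lam T := by
  simp only [quadrantSVT, Finset.mem_image, Finset.mem_filter, Finset.mem_univ, true_and]
  constructor
  · rintro ⟨T, ⟨h1, h2, h3⟩, rfl⟩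
    refine ⟨fun r c => ⟨?_, ?_⟩, fun r c a ha => ?_, fun r c c' hc a ha a' ha' => ?_,
      fun r r' c hr a ha a' ha' => ?_⟩
    · rintro ⟨a, ha⟩
      obtain ⟨hr, hc, -⟩ := exists_of_mem_extendFilling ha
      exact ⟨hr, hc⟩
    · rintro ⟨hr, hc⟩
      have := extendFilling_apply T ⟨r, hr⟩ ⟨c, hc⟩
      dsimp only at this
      rw [this, Finset.map_nonempty]
      exact h1 _
    · obtain ⟨_, _, h, _⟩ := exists_of_mem_extendFilling ha
      exact h
    · obtain ⟨hr, _, _, hm⟩ := exists_of_mem_extendFilling ha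
      obtain ⟨_, _, _, hm'⟩ := exists_of_mem_extendFilling ha'
      exact h2 ⟨r, hr⟩ _ _ hc _ hm _ hm'
    · obtain ⟨_, _, _, hm⟩ := exists_of_mem_extendFilling ha
      obtain ⟨_, _, _, hm'⟩ := exists_of_mem_extendFilling ha'
      exact h3 ⟨r, _⟩ ⟨r', _⟩ _ _ hr rfl _ hm _ hm'
  · intro h
    have hmem : ∀ (b : YBox n lam) (a : Fin n),
        a ∈ Finset.univ.filter (fun a : Fin n => (a : ℕ) ∈ T b.1 b.2) ↔ (a : ℕ) ∈ T b.1 b.2 := by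
      simp
    refine ⟨fun b => Finset.univ.filter fun a : Fin n => (a : ℕ) ∈ T b.1 b.2,
      ⟨fun b => ?_, fun r c c' hc a ha a' ha' => ?_, fun r r' c c' hr hc a ha a' ha' => ?_⟩, ?_⟩
    · obtain ⟨a, ha⟩ := (h.nonempty_iff b.1 b.2).2 ⟨b.1.2, b.2.2⟩
      exact ⟨⟨a, h.lt _ _ a ha⟩, (hmem _ _).2 ha⟩
    · exact h.row r c c' hc _ ((hmem _ _).1 ha) _ ((hmem _ _).1 ha')
    · refine h.col r r' c hr _ ((hmem _ _).1 ha) _ ?_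
      rw [hc]
      exact (hmem _ _).1 ha'
    · funext r c
      ext a
      constructor
      · intro ha
        obtain ⟨_, _, _, hm⟩ := exists_of_mem_extendFilling ha
        exact (hmem _ _).1 hm
      · intro ha
        have hb := (h.nonempty_iff r c).1 ⟨a, ha⟩
        rw [extendFilling, dif_pos hb, Finset.mem_map]
        exact ⟨⟨a, h.lt _ _ a ha⟩, (hmem ⟨⟨r, hb.1⟩, ⟨c, hb.2⟩⟩ _).2 ha, rfl⟩

/-- The contribution of one box of a set-valued tableau, in a row with parameter `s`. -/
def setWeight (y : ℕ → R) (s : R) (A : Finset ℕ) : R :=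
  (-s) ^ (A.card - 1) * ∏ v ∈ A, y v

/-- The signed weight of a set-valued tableau. -/
def fillingWeight (n : ℕ) (lam : ℕ → ℕ) (y s : ℕ → R) (T : ℕ → ℕ → Finset ℕ) : R :=
  ∏ r ∈ Finset.range n, ∏ c ∈ Finset.range (lam r), setWeight y (s r) (T r c)

theorem grothendieck_eq_sum_quadrantSVT (n : ℕ) (lam : ℕ → ℕ) (x t : ℕ → R) :
    grothendieck n n lam x t = ∑ T ∈ quadrantSVT n lam,
      fillingWeight n lam (fun a => x (a + 1)) (fun a => t (a + 1)) T := by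
  rw [quadrantSVT, Finset.sum_image (extendFilling_injective n lam).injOn, grothendieck]
  refine Finset.sum_congr rfl fun T _ => ?_
  rw [← Finset.prod_pow_eq_pow_sum, ← Finset.prod_mul_distrib, ← Finset.prod_mul_distrib,
    fillingWeight, Finset.prod_range, Fintype.prod_sigma]
  refine Finset.prod_congr rfl fun r _ => ?_
  rw [Finset.prod_range]
  refine Finset.prod_congr rfl fun c _ => ?_
  rw [extendFilling_apply, setWeight, Finset.card_map, Finset.prod_map, ← mul_pow, neg_one_mul]
  rfl

theorem setWeight_empty (y : ℕ → R) (s : R) : setWeight y s ∅ = 1 := by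
  simp [setWeight]

theorem setWeight_insert {y : ℕ → R} {s : R} {A : Finset ℕ} {n : ℕ} (hn : n ∉ A) :
    setWeight y s (insert n A) = y n * (if A.Nonempty then -s else 1) * setWeight y s A := by
  rw [setWeight, setWeight, Finset.prod_insert hn, Finset.card_insert_of_notMem hn]
  split_ifs with h
  · obtain ⟨k, hk⟩ : ∃ k, A.card = k + 1 := ⟨A.card - 1, by have := h.card_pos; omega⟩
    rw [hk]
    simp only [Nat.add_sub_cancel]
    ring
  · rw [Finset.not_nonempty_iff_eq_empty.1 h]
    simp

theorem prod_range_ite_eq_pow {a b L : ℕ} (hb : b ≤ L) (z : R) :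
    ∏ c ∈ Finset.range L, (if a ≤ c ∧ c < b then z else 1) = z ^ (b - a) := by
  rw [← Finset.prod_filter, Finset.prod_const]
  congr 1
  rw [← Nat.card_Ico]
  congr 1
  ext c
  simp only [Finset.mem_filter, Finset.mem_range, Finset.mem_Ico]
  omega

theorem lt_card_filter_range_iff {L : ℕ} {Q : ℕ → Prop} [DecidablePred Q]
    (hQ : ∀ c c', c < c' → c' < L → Q c' → Q c) {c : ℕ} (hc : c < L) :
    c < ((Finset.range L).filter Q).card ↔ Q c := by
  constructor
  · intro h
    by_contra hn
    have hsub : (Finset.range L).filter Q ⊆ Finset.range c := by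
      intro d hd
      rw [Finset.mem_filter, Finset.mem_range] at hd
      rw [Finset.mem_range]
      by_contra hdc
      rcases (not_lt.1 hdc).eq_or_lt with rfl | hlt
      · exact hn hd.2
      · exact hn (hQ c d hlt hd.1 hd.2)
    have := Finset.card_le_card hsub
    rw [Finset.card_range] at this
    omega
  · intro h
    have hsub : Finset.range (c + 1) ⊆ (Finset.range L).filter Q := by
      intro d hd
      rw [Finset.mem_range] at hd
      rw [Finset.mem_filter, Finset.mem_range]
      refine ⟨by omega, ?_⟩
      rcases (Nat.lt_succ_iff.1 hd).eq_or_lt with rfl | hlt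
      · exact h
      · exact hQ d c hlt hc h
    have := Finset.card_le_card hsub
    rw [Finset.card_range] at this
    omega

theorem card_filter_range_lt {L m : ℕ} {Q : ℕ → Prop} [DecidablePred Q] (hm : m ≤ L)
    (hQ : ∀ c < L, (Q c ↔ c < m)) : ((Finset.range L).filter Q).card = m := by
  conv_rhs => rw [← Finset.card_range m]
  congr 1
  ext c
  rw [Finset.mem_filter, Finset.mem_range, Finset.mem_range]
  constructor
  · rintro ⟨h1, h2⟩
    exact (hQ c h1).1 h2
  · intro h
    exact ⟨h.trans_le hm, (hQ c (h.trans_le hm)).2 h⟩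

/-- The number of boxes in row `r` that do not contain `n`. -/
def boxesWithout (n : ℕ) (lam : ℕ → ℕ) (T : ℕ → ℕ → Finset ℕ) (r : ℕ) : ℕ :=
  ((Finset.range (lam r)).filter fun c => n ∉ T r c).card

/-- The number of boxes in row `r` that contain a letter other than `n`. -/
def boxesWithOther (n : ℕ) (lam : ℕ → ℕ) (T : ℕ → ℕ → Finset ℕ) (r : ℕ) : ℕ :=
  ((Finset.range (lam r)).filter fun c => ((T r c).erase n).Nonempty).card

/-- Insert the letter `n` into the boxes `ν r ≤ c < lam r` of each row `r ≤ n`. -/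
def insertLetter (n : ℕ) (lam ν : ℕ → ℕ) (T : ℕ → ℕ → Finset ℕ) : ℕ → ℕ → Finset ℕ :=
  fun r c => if r ≤ n ∧ ν r ≤ c ∧ c < lam r then insert n (T r c) else T r c

theorem mem_insertLetter {n : ℕ} {lam ν : ℕ → ℕ} {T : ℕ → ℕ → Finset ℕ} {r c a : ℕ} :
    a ∈ insertLetter n lam ν T r c ↔
      a ∈ T r c ∨ (a = n ∧ r ≤ n ∧ ν r ≤ c ∧ c < lam r) := by
  unfold insertLetter
  split_ifs with h
  · rw [Finset.mem_insert]
    tauto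
  · tauto

namespace IsQuadrantSVT

variable {n : ℕ} {lam : ℕ → ℕ} {T : ℕ → ℕ → Finset ℕ}

theorem row_le (hlam : ∀ i < n, lam (i + 1) ≤ lam i) (h : IsQuadrantSVT (n + 1) lam T) :
    ∀ r c, ∀ a ∈ T r c, r ≤ a := by
  intro r
  induction r with
  | zero => intro _ _ _; exact Nat.zero_le _
  | succ r ih =>
    intro c a ha
    have hb := (h.nonempty_iff _ _).1 ⟨a, ha⟩
    obtain ⟨a', ha'⟩ := (h.nonempty_iff r c).2
      ⟨by omega, hb.2.trans_le (hlam r (by omega))⟩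
    have h1 := ih c a' ha'
    have h2 := h.col r (r + 1) c (Nat.lt_succ_self r) a' ha' a ha
    omega

theorem lt_boxesWithout_iff (h : IsQuadrantSVT (n + 1) lam T) {r c : ℕ} (hr : r ≤ n)
    (hc : c < lam r) : c < boxesWithout n lam T r ↔ n ∉ T r c := by
  refine lt_card_filter_range_iff (L := lam r) (Q := fun c => n ∉ T r c)
    (fun d d' hd hd' hn hn' => ?_) hc
  obtain ⟨a, ha⟩ := (h.nonempty_iff r d').2 ⟨by omega, hd'⟩
  have h1 := h.row r d d' hd n hn' a ha
  have h2 := h.lt r d' a ha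
  obtain rfl : a = n := by omega
  exact hn ha

theorem lt_boxesWithOther_iff (h : IsQuadrantSVT (n + 1) lam T) {r c : ℕ} (hr : r ≤ n)
    (hc : c < lam r) : c < boxesWithOther n lam T r ↔ ((T r c).erase n).Nonempty := by
  refine lt_card_filter_range_iff (L := lam r) (Q := fun c => ((T r c).erase n).Nonempty)
    (fun d d' hd hd' hn => ?_) hc
  obtain ⟨a', ha'⟩ := hn
  rw [Finset.mem_erase] at ha'
  obtain ⟨a, ha⟩ := (h.nonempty_iff r d).2 ⟨by omega, by omega⟩
  have h1 := h.row r d d' hd a ha a' ha'.2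
  have h2 := h.lt r d' a' ha'.2
  have h3 := ha'.1
  exact ⟨a, Finset.mem_erase.2 ⟨by omega, ha⟩⟩

theorem boxesWithout_le (r : ℕ) : boxesWithout n lam T r ≤ lam r :=
  (Finset.card_filter_le _ _).trans (Finset.card_range _).le

theorem boxesWithOther_le (r : ℕ) : boxesWithOther n lam T r ≤ lam r :=
  (Finset.card_filter_le _ _).trans (Finset.card_range _).le

theorem boxesWithout_le_boxesWithOther (h : IsQuadrantSVT (n + 1) lam T) {r : ℕ} (hr : r ≤ n) :
    boxesWithout n lam T r ≤ boxesWithOther n lam T r := by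
  by_contra! hlt
  have hc := hlt.trans_le (boxesWithout_le r)
  rw [h.lt_boxesWithout_iff hr hc] at hlt
  refine lt_irrefl _ ((h.lt_boxesWithOther_iff hr hc).2 ?_)
  rw [Finset.erase_eq_of_notMem hlt]
  exact (h.nonempty_iff _ _).2 ⟨by omega, hc⟩

theorem boxesWithOther_le_succ (h : IsQuadrantSVT (n + 1) lam T) {r : ℕ} (hr : r ≤ n) :
    boxesWithOther n lam T r ≤ boxesWithout n lam T r + 1 := by
  by_contra! hlt
  have hc := hlt.trans_le (boxesWithOther_le r)
  rw [h.lt_boxesWithOther_iff hr hc] at hlt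
  obtain ⟨a, ha⟩ := hlt
  rw [Finset.mem_erase] at ha
  have hn : n ∈ T r (boxesWithout n lam T r) := by
    by_contra hn
    exact lt_irrefl _ ((h.lt_boxesWithout_iff hr (by omega)).2 hn)
  have h1 := h.row r _ _ (Nat.lt_succ_self _) n hn a ha.2
  have h2 := h.lt r _ a ha.2
  have h3 := ha.1
  omega

theorem le_boxesWithout (hlam : ∀ i < n, lam (i + 1) ≤ lam i)
    (h : IsQuadrantSVT (n + 1) lam T) {r : ℕ} (hr : r < n) :
    lam (r + 1) ≤ boxesWithout n lam T r := by
  by_contra! hlt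
  have hn := (h.lt_boxesWithout_iff hr.le (hlt.trans_le (hlam r hr))).not.1 (lt_irrefl _)
  rw [not_not] at hn
  obtain ⟨a, ha⟩ := (h.nonempty_iff (r + 1) _).2 ⟨by omega, hlt⟩
  have h1 := h.col r (r + 1) _ (Nat.lt_succ_self r) n hn a ha
  have h2 := h.lt _ _ a ha
  omega

theorem erase (hlam : ∀ i < n, lam (i + 1) ≤ lam i) (h : IsQuadrantSVT (n + 1) lam T) :
    IsQuadrantSVT n (extendFin n fun i => boxesWithOther n lam T i)
      (fun r c => (T r c).erase n) where
  nonempty_iff r c := by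
    constructor
    · rintro hne
      obtain ⟨a, ha⟩ := id hne
      rw [Finset.mem_erase] at ha
      have h1 := (h.nonempty_iff r c).1 ⟨a, ha.2⟩
      have h2 := h.row_le hlam r c a ha.2
      have h3 := h.lt r c a ha.2
      have h4 := ha.1
      have hr : r < n := by omega
      refine ⟨hr, ?_⟩
      rw [extendFin, dif_pos hr]
      exact (h.lt_boxesWithOther_iff hr.le h1.2).2 hne
    · rintro ⟨hr, hc⟩
      rw [extendFin, dif_pos hr] at hc
      exact (h.lt_boxesWithOther_iff hr.le (hc.trans_le (boxesWithOther_le r))).1 hc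
  lt r c a ha := by
    rw [Finset.mem_erase] at ha
    have := h.lt r c a ha.2
    have := ha.1
    omega
  row r c c' hc a ha a' ha' :=
    h.row r c c' hc a (Finset.mem_of_mem_erase ha) a' (Finset.mem_of_mem_erase ha')
  col r r' c hr a ha a' ha' :=
    h.col r r' c hr a (Finset.mem_of_mem_erase ha) a' (Finset.mem_of_mem_erase ha')

theorem insertLetter_erase (hlam : ∀ i < n, lam (i + 1) ≤ lam i)
    (h : IsQuadrantSVT (n + 1) lam T) :
    insertLetter n lam (extendFin n fun i => boxesWithout n lam T i)
      (fun r c => (T r c).erase n) = T := by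
  funext r c
  ext a
  rw [mem_insertLetter, Finset.mem_erase]
  constructor
  · rintro (ha | ⟨rfl, hr, hν, hc⟩)
    · exact ha.2
    · rcases hr.lt_or_eq with hr' | rfl
      · rw [extendFin, dif_pos hr'] at hν
        by_contra hn
        exact absurd ((h.lt_boxesWithout_iff hr hc).2 hn) (not_lt.2 hν)
      · obtain ⟨a, ha⟩ := (h.nonempty_iff r c).2 ⟨by omega, hc⟩
        have h1 := h.row_le hlam r c a ha
        have h2 := h.lt r c a ha
        obtain rfl : a = r := by omega
        exact ha
  · intro ha
    by_cases han : a = n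
    · subst han
      have hb := (h.nonempty_iff r c).1 ⟨a, ha⟩
      refine Or.inr ⟨rfl, by omega, ?_, hb.2⟩
      unfold extendFin
      split_ifs with hr
      · by_contra hlt
        exact (h.lt_boxesWithout_iff hr.le hb.2).1 (not_le.1 hlt) ha
      · exact Nat.zero_le _
    · exact Or.inl ⟨han, ha⟩

end IsQuadrantSVT

section InsertLetter

variable {n : ℕ} {lam : ℕ → ℕ} {p : Fin n → ℕ × ℕ} {T : ℕ → ℕ → Finset ℕ}

theorem le_of_forall_succ_le (hlam : ∀ i < n, lam (i + 1) ≤ lam i) {r r' : ℕ} (hr : r ≤ r')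
    (hr' : r' ≤ n) : lam r' ≤ lam r := by
  induction r', hr using Nat.le_induction with
  | base => exact le_rfl
  | succ m _ ih => exact (hlam m (by omega)).trans (ih (by omega))

theorem isQuadrantSVT_insertLetter (hlam : ∀ i < n, lam (i + 1) ≤ lam i)
    (hp : ∀ i : Fin n, p i ∈ rowChoices (lam (i + 1)) (lam i))
    (h : IsQuadrantSVT n (extendFin n fun i => (p i).1 + (p i).2) T) :
    IsQuadrantSVT (n + 1) lam (insertLetter n lam (extendFin n fun i => (p i).1) T) := by
  have key : ∀ r c a, a ∈ T r c →
      ∃ hr : r < n, c < (p ⟨r, hr⟩).1 + (p ⟨r, hr⟩).2 ∧ a < n := by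
    intro r c a ha
    obtain ⟨hr, hc⟩ := (h.nonempty_iff r c).1 ⟨a, ha⟩
    rw [extendFin, dif_pos hr] at hc
    exact ⟨hr, hc, h.lt r c a ha⟩
  have hp' := fun i => mem_rowChoices.1 (hp i)
  constructor
  · intro r c
    constructor
    · rintro ⟨a, ha⟩
      rcases mem_insertLetter.1 ha with ha | ⟨-, hr, -, hc⟩
      · obtain ⟨hr, hc, -⟩ := key r c a ha
        have := hp' ⟨r, hr⟩
        dsimp only at this
        exact ⟨by omega, by omega⟩
      · exact ⟨by omega, hc⟩
    · rintro ⟨hr, hc⟩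
      by_cases hν : (extendFin n fun i => (p i).1) r ≤ c
      · exact ⟨n, mem_insertLetter.2 (Or.inr ⟨rfl, by omega, hν, hc⟩)⟩
      · have hrn : r < n := by
          by_contra hrn
          rw [extendFin, dif_neg hrn] at hν
          omega
        rw [extendFin, dif_pos hrn] at hν
        obtain ⟨a, ha⟩ := (h.nonempty_iff r c).2 ⟨hrn, by rw [extendFin, dif_pos hrn]; omega⟩
        exact ⟨a, mem_insertLetter.2 (Or.inl ha)⟩
  · intro r c a ha
    rcases mem_insertLetter.1 ha with ha | ⟨rfl, -⟩
    · have := h.lt r c a ha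
      omega
    · exact Nat.lt_succ_self _
  · intro r c c' hc a ha a' ha'
    rcases mem_insertLetter.1 ha with hm | ⟨rfl, hr, hν, hlt⟩
    · rcases mem_insertLetter.1 ha' with ha' | ⟨rfl, -⟩
      · exact h.row r c c' hc a hm a' ha'
      · exact (h.lt r c a hm).le
    · rcases mem_insertLetter.1 ha' with ha' | ⟨rfl, -⟩
      · obtain ⟨hr', hc', -⟩ := key r c' a' ha'
        rw [extendFin, dif_pos hr'] at hν
        have := hp' ⟨r, hr'⟩
        omega
      · exact le_rfl
  · intro r r' c hr a ha a' ha'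
    have hb : r' ≤ n ∧ c < lam r' := by
      rcases mem_insertLetter.1 ha' with ha' | ⟨-, h1, -, h2⟩
      · obtain ⟨hr', hc, -⟩ := key r' c a' ha'
        have := hp' ⟨r', hr'⟩
        dsimp only at this
        exact ⟨by omega, by omega⟩
      · exact ⟨h1, h2⟩
    rcases mem_insertLetter.1 ha with hm | ⟨rfl, -, hν, -⟩
    · rcases mem_insertLetter.1 ha' with ha' | ⟨rfl, -⟩
      · exact h.col r r' c hr a hm a' ha'
      · exact h.lt r c a hm
    · exfalso
      have hrn : r < a := by omega
      rw [extendFin, dif_pos hrn] at hν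
      have h1 := hp' ⟨r, hrn⟩
      have h2 := le_of_forall_succ_le hlam (show r + 1 ≤ r' by omega) hb.1
      dsimp only at h1
      omega

theorem notMem_of_isQuadrantSVT {μ : ℕ → ℕ} (h : IsQuadrantSVT n μ T) (r c : ℕ) : n ∉ T r c :=
  fun hn => lt_irrefl n (h.lt r c n hn)

theorem erase_insertLetter {μ ν : ℕ → ℕ} (h : IsQuadrantSVT n μ T) (r c : ℕ) :
    (insertLetter n lam ν T r c).erase n = T r c := by
  have hn := notMem_of_isQuadrantSVT h r c
  unfold insertLetter
  split_ifs
  · exact Finset.erase_insert hn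
  · exact Finset.erase_eq_of_notMem hn

theorem boxesWithout_insertLetter {μ : ℕ → ℕ} (h : IsQuadrantSVT n μ T)
    (hp : ∀ i : Fin n, p i ∈ rowChoices (lam (i + 1)) (lam i)) (i : Fin n) :
    boxesWithout n lam (insertLetter n lam (extendFin n fun i => (p i).1) T) i = (p i).1 := by
  have hi := mem_rowChoices.1 (hp i)
  refine card_filter_range_lt (L := lam i) (m := (p i).1) (by omega) (Q := fun c => n ∉ insertLetter n lam
    (extendFin n fun i => (p i).1) T i c) fun c hc => ?_
  have hn := notMem_of_isQuadrantSVT h i c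
  have hin := i.2
  rw [mem_insertLetter, extendFin, dif_pos i.2]
  simp only [hn, hc, false_or, true_and, and_true, Fin.eta, hin.le, not_le]

theorem boxesWithOther_insertLetter
    (h : IsQuadrantSVT n (extendFin n fun i => (p i).1 + (p i).2) T)
    (hp : ∀ i : Fin n, p i ∈ rowChoices (lam (i + 1)) (lam i)) (i : Fin n) :
    boxesWithOther n lam (insertLetter n lam (extendFin n fun i => (p i).1) T) i =
      (p i).1 + (p i).2 := by
  have hi := mem_rowChoices.1 (hp i)
  refine card_filter_range_lt (L := lam i) (m := (p i).1 + (p i).2) (by omega) (Q := fun c =>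
    ((insertLetter n lam (extendFin n fun i => (p i).1) T i c).erase n).Nonempty) fun c hc => ?_
  rw [erase_insertLetter h, h.nonempty_iff, extendFin, dif_pos i.2]
  simp

theorem prod_setWeight_insertLetter {μ ν : ℕ → ℕ} (h : IsQuadrantSVT n μ T) {r : ℕ} (hr : r ≤ n)
    (y : ℕ → R) (s : R) {m : ℕ} (hm : m ≤ lam r) (hT : ∀ c, (T r c).Nonempty ↔ c < m) :
    ∏ c ∈ Finset.range (lam r), setWeight y s (insertLetter n lam ν T r c) =
      y n ^ (lam r - ν r) * (-s) ^ (m - ν r) *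
        ∏ c ∈ Finset.range m, setWeight y s (T r c) := by
  rw [← prod_range_ite_eq_pow le_rfl (y n), ← prod_range_ite_eq_pow hm (-s),
    Finset.prod_subset (Finset.range_mono hm) (f := fun c => setWeight y s (T r c)),
    ← Finset.prod_mul_distrib, ← Finset.prod_mul_distrib]
  · refine Finset.prod_congr rfl fun c hc => ?_
    rw [Finset.mem_range] at hc
    unfold insertLetter
    by_cases hν : ν r ≤ c
    · rw [if_pos ⟨hr, hν, hc⟩, setWeight_insert (notMem_of_isQuadrantSVT h r c)]
      simp only [hν, hc, hT, true_and, and_true, if_true]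
    · simp [hν]
  · intro c _ hc
    rw [Finset.mem_range, ← hT, Finset.not_nonempty_iff_eq_empty] at hc
    rw [hc, setWeight_empty]

theorem fillingWeight_insertLetter
    (h : IsQuadrantSVT n (extendFin n fun i => (p i).1 + (p i).2) T)
    (hp : ∀ i : Fin n, p i ∈ rowChoices (lam (i + 1)) (lam i)) (y s : ℕ → R) :
    fillingWeight (n + 1) lam y s (insertLetter n lam (extendFin n fun i => (p i).1) T) =
      y n ^ lam n * ((∏ i : Fin n, y n ^ (lam i - (p i).1) * (-s i) ^ (p i).2) *
        fillingWeight n (extendFin n fun i => (p i).1 + (p i).2) y s T) := by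
  rw [fillingWeight, Finset.prod_range_succ, mul_comm, fillingWeight]
  congr 1
  · rw [prod_setWeight_insertLetter h le_rfl y (s n) (Nat.zero_le _)]
    · simp [extendFin]
    · intro c
      rw [h.nonempty_iff]
      simp
  · rw [Finset.prod_range, Finset.prod_range, ← Finset.prod_mul_distrib]
    refine Finset.prod_congr rfl fun i _ => ?_
    have hi := mem_rowChoices.1 (hp i)
    have e : (extendFin n fun i => (p i).1 + (p i).2) i = (p i).1 + (p i).2 := dif_pos i.2
    have e' : (extendFin n fun i => (p i).1) i = (p i).1 := dif_pos i.2
    rw [prod_setWeight_insertLetter h i.2.le y (s i) (m := (p i).1 + (p i).2) (by omega), e, e',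
      Nat.add_sub_cancel_left]
    intro c
    rw [h.nonempty_iff, e]
    simp

end InsertLetter

theorem sum_quadrantSVT_succ {n : ℕ} {lam : ℕ → ℕ} (hlam : ∀ i < n, lam (i + 1) ≤ lam i)
    (y s : ℕ → R) :
    ∑ T ∈ quadrantSVT (n + 1) lam, fillingWeight (n + 1) lam y s T =
      y n ^ lam n * ∑ p ∈ Fintype.piFinset fun i : Fin n => rowChoices (lam (i + 1)) (lam i),
        (∏ i : Fin n, y n ^ (lam i - (p i).1) * (-s i) ^ (p i).2) *
          ∑ T ∈ quadrantSVT n (extendFin n fun i => (p i).1 + (p i).2),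
            fillingWeight n (extendFin n fun i => (p i).1 + (p i).2) y s T := by
  simp only [Finset.mul_sum]
  rw [Finset.sum_sigma']
  symm
  refine Finset.sum_bij'
    (fun q _ => insertLetter n lam (extendFin n fun i => (q.1 i).1) q.2)
    (fun T _ => ⟨fun i => (boxesWithout n lam T i,
      boxesWithOther n lam T i - boxesWithout n lam T i), fun r c => (T r c).erase n⟩)
    ?_ ?_ ?_ ?_ ?_
  · rintro ⟨p, T⟩ hq
    simp only [Finset.mem_sigma, Fintype.mem_piFinset, mem_quadrantSVT] at hq ⊢
    exact isQuadrantSVT_insertLetter hlam hq.1 hq.2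
  · intro T hT
    simp only [Finset.mem_sigma, Fintype.mem_piFinset, mem_quadrantSVT] at hT ⊢
    refine ⟨fun i => mem_rowChoices.2 ?_, ?_⟩
    · have h1 := hT.boxesWithout_le_boxesWithOther i.2.le
      have h2 := hT.boxesWithOther_le_succ i.2.le
      have h3 := hT.le_boxesWithout hlam i.2
      have h4 := IsQuadrantSVT.boxesWithOther_le (n := n) (lam := lam) (T := T) i
      refine ⟨h3, ?_, ?_⟩ <;> dsimp only <;> omega
    · convert hT.erase hlam using 3 with i
      exact Nat.add_sub_cancel' (hT.boxesWithout_le_boxesWithOther i.2.le)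
  · rintro ⟨p, T⟩ hq
    simp only [Finset.mem_sigma, Fintype.mem_piFinset, mem_quadrantSVT] at hq
    simp only [boxesWithout_insertLetter hq.2 hq.1, boxesWithOther_insertLetter hq.2 hq.1,
      erase_insertLetter hq.2, Nat.add_sub_cancel_left]
  · intro T hT
    exact (mem_quadrantSVT.1 hT).insertLetter_erase hlam
  · rintro ⟨p, T⟩ hq
    simp only [Finset.mem_sigma, Fintype.mem_piFinset, mem_quadrantSVT] at hq
    rw [fillingWeight_insertLetter hq.2 hq.1]

theorem quadrantSVT_zero_shape (n : ℕ) (y s : ℕ → R) :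
    ∑ T ∈ quadrantSVT n fun _ => 0, fillingWeight n (fun _ => 0) y s T = 1 := by
  have h : quadrantSVT n (fun _ => 0) = {fun _ _ => ∅} := by
    ext T
    rw [mem_quadrantSVT, Finset.mem_singleton]
    constructor
    · intro h
      funext r c
      rw [← Finset.not_nonempty_iff_eq_empty, h.nonempty_iff]
      simp
    · rintro rfl
      constructor <;> simp
  rw [h, Finset.sum_singleton]
  simp [fillingWeight]

/-- The bialternant formula. -/
theorem sum_quadrantSVT_mul_prod_sub [IsDomain R] {y s : ℕ → R}
    (hys : ∀ i k, 1 - s i * y k ≠ 0) (n : ℕ) (lam : ℕ → ℕ)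
    (hlam : ∀ i, i + 1 < n → lam (i + 1) ≤ lam i) :
    (∏ k ∈ Finset.range n, ∏ l ∈ Finset.range k, (y l - y k)) *
        ∑ T ∈ quadrantSVT n lam, fillingWeight n lam y s T =
      (alternant n lam y s).det := by
  induction n generalizing lam with
  | zero =>
    have h : quadrantSVT 0 lam = {fun _ _ => ∅} := by
      ext T
      rw [mem_quadrantSVT, Finset.mem_singleton]
      constructor
      · intro h
        funext r c
        rw [← Finset.not_nonempty_iff_eq_empty, h.nonempty_iff]
        simp
      · rintro rfl
        constructor <;> simp
    rw [h, Finset.sum_singleton]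
    simp [fillingWeight]
  | succ n ih =>
    have hlam' : ∀ i < n, lam (i + 1) ≤ lam i := fun i hi => hlam i (by omega)
    have hprod : ∏ i ∈ Finset.range n, (1 - s i * y n) ≠ 0 :=
      Finset.prod_ne_zero_iff.2 fun i _ => hys i n
    refine mul_left_cancel₀ hprod ?_
    rw [det_alternant_succ hlam', sum_quadrantSVT_succ hlam', Finset.prod_range_succ]
    congr 1
    rw [mul_comm (∏ k ∈ Finset.range n, ∏ l ∈ Finset.range k, (y l - y k)), mul_assoc]
    congr 1
    rw [mul_left_comm, Finset.mul_sum]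
    congr 1
    refine Finset.sum_congr rfl fun p hp => ?_
    rw [mul_left_comm, ih]
    intro i hi
    unfold extendFin
    rw [dif_pos hi, dif_pos (by omega : i < n)]
    dsimp only
    have h1 := mem_rowChoices.1 (Fintype.mem_piFinset.1 hp ⟨i, by omega⟩)
    have h2 := mem_rowChoices.1 (Fintype.mem_piFinset.1 hp ⟨i + 1, hi⟩)
    dsimp only at h1 h2
    omega

theorem sum_quadrantSVT_eq_det [IsDomain R] {y s : ℕ → R}
    (hys : ∀ i k, 1 - s i * y k ≠ 0) (hy : Function.Injective y) (n : ℕ) (lam : ℕ → ℕ)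
    (hlam : ∀ i, i + 1 < n → lam (i + 1) ≤ lam i) :
    ∑ T ∈ quadrantSVT n lam, fillingWeight n lam y s T = (jacobiTrudi n lam y s).det := by
  have h0 := sum_quadrantSVT_mul_prod_sub (y := y) (s := fun _ => 0) (by simp) n (fun _ => 0)
    (by simp)
  rw [quadrantSVT_zero_shape, mul_one, ← det_omitMatrix] at h0
  have hV : ∏ k ∈ Finset.range n, ∏ l ∈ Finset.range k, (y l - y k) ≠ 0 := by
    refine Finset.prod_ne_zero_iff.2 fun k _ => Finset.prod_ne_zero_iff.2 fun l hl => ?_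
    exact sub_ne_zero.2 fun h => (Finset.mem_range.1 hl).ne (hy h)
  refine mul_left_cancel₀ hV ?_
  rw [sum_quadrantSVT_mul_prod_sub hys n lam hlam, ← jacobiTrudi_mul_omitMatrix, Matrix.det_mul,
    h0, mul_comm]

section Map

variable {S : Type*} [CommRing S] (φ : S →+* R)

theorem map_sum_quadrantSVT (n : ℕ) (lam : ℕ → ℕ) (y s : ℕ → S) :
    φ (∑ T ∈ quadrantSVT n lam, fillingWeight n lam y s T) =
      ∑ T ∈ quadrantSVT n lam, fillingWeight n lam (φ ∘ y) (φ ∘ s) T := by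
  simp [fillingWeight, setWeight]

theorem map_hSeries (n : ℕ) (y : ℕ → S) :
    PowerSeries.map φ (hSeries ((List.range n).map y)) =
      hSeries ((List.range n).map (φ ∘ y)) := by
  have h := congrArg (PowerSeries.map φ) (hSeries_range_mul_prod n y)
  rw [map_mul, map_one, map_prod] at h
  simp only [map_sub, map_one, map_mul, PowerSeries.map_C, PowerSeries.map_X] at h
  exact left_inv_eq_right_inv h (by rw [mul_comm]; exact hSeries_range_mul_prod n (φ ∘ y))

theorem map_jacobiTrudi (n : ℕ) (lam : ℕ → ℕ) (y s : ℕ → S) :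
    φ (jacobiTrudi n lam y s).det = (jacobiTrudi n lam (φ ∘ y) (φ ∘ s)).det := by
  rw [RingHom.map_det]
  congr 1
  ext i j
  simp only [jacobiTrudi, RingHom.mapMatrix_apply, Matrix.map_apply, Matrix.of_apply]
  rw [← PowerSeries.coeff_map, map_mul, map_hSeries, map_prod]
  simp

end Map

theorem grothendieck_eq_det_jacobiTrudi (n : ℕ) (lam : ℕ → ℕ)
    (hlam : ∀ a b : ℕ, a ≤ b → b < n → lam b ≤ lam a) (x t : ℕ → R) :
    grothendieck n n lam x t =
      (jacobiTrudi n lam (fun a => x (a + 1)) fun a => t (a + 1)).det := by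
  let Y : ℕ → MvPolynomial (ℕ ⊕ ℕ) ℤ := fun a => MvPolynomial.X (Sum.inl a)
  let S : ℕ → MvPolynomial (ℕ ⊕ ℕ) ℤ := fun a => MvPolynomial.X (Sum.inr a)
  let φ : MvPolynomial (ℕ ⊕ ℕ) ℤ →+* R :=
    MvPolynomial.eval₂Hom (Int.castRingHom R)
      (Sum.elim (fun a => x (a + 1)) fun a => t (a + 1))
  have hY : φ ∘ Y = fun a => x (a + 1) := by
    funext a
    simp [φ, Y]
  have hS : φ ∘ S = fun a => t (a + 1) := by
    funext a
    simp [φ, S]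
  have h := congrArg φ (sum_quadrantSVT_eq_det (y := Y) (s := S) (fun i k h => ?_)
    (fun a b hab => Sum.inl_injective (MvPolynomial.X_injective hab)) n lam
    fun i hi => hlam i (i + 1) (Nat.le_succ i) hi)
  · rw [grothendieck_eq_sum_quadrantSVT]
    rwa [map_sum_quadrantSVT, map_jacobiTrudi, hY, hS] at h
  · have := congrArg MvPolynomial.constantCoeff h
    simp [Y, S] at this

/-- **Jacobi–Trudi formulas for refined Grothendieck polynomials.**
For a partition `λ` with at most `n` parts,
`G_λ(x;t) = det[ Σ_{k≥0} e_{k-λ_i+i-j}(-t_1,…,-t_{i-1}) h_k(x) ]_{i,j=1}^n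
          = det[ Σ_{k≥0} e_k(-t_1,…,-t_{i-1}) h_{k+λ_i-i+j}(x) ]_{i,j=1}^n`,
where each inner sum (taken here as a `finsum` over `k : ℕ`) has finitely many
nonzero terms. -/
theorem refined_grothendieck_jacobi_trudi
    {R : Type*} [CommRing R] (n : ℕ) (lam : ℕ → ℕ)
    (hlam : ∀ a b : ℕ, a ≤ b → b < n → lam b ≤ lam a)
    (x t : ℕ → R) :
    grothendieck n n lam x t =
        Matrix.det (Matrix.of fun i j : Fin n =>
          ∑ᶠ k : ℕ,
            eInt ((k : ℤ) - (lam i.1 : ℤ) + (i.1 : ℤ) - (j.1 : ℤ))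
                ((List.range i.1).map fun a => -t (a + 1)) *
              hL k ((List.range n).map fun a => x (a + 1))) ∧
      grothendieck n n lam x t =
        Matrix.det (Matrix.of fun i j : Fin n =>
          ∑ᶠ k : ℕ,
            eL k ((List.range i.1).map fun a => -t (a + 1)) *
              hInt ((k : ℤ) + (lam i.1 : ℤ) - (i.1 : ℤ) + (j.1 : ℤ))
                ((List.range n).map fun a => x (a + 1))) := by
  have hsnd : grothendieck n n lam x t =
      Matrix.det (Matrix.of fun i j : Fin n => ∑ᶠ k : ℕ,
        eL k ((List.range i.1).map fun a => -t (a + 1)) *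
          hInt ((k : ℤ) + (lam i.1 : ℤ) - (i.1 : ℤ) + (j.1 : ℤ))
            ((List.range n).map fun a => x (a + 1))) := by
    rw [grothendieck_eq_det_jacobiTrudi n lam hlam]
    congr 1
    ext i j
    have h := finsum_eL_mul_hInt ((List.range i.1).map fun a => -t (a + 1))
      ((List.range n).map fun a => x (a + 1)) ((lam i + j : ℕ) : ℤ)
    rw [List.map_map, coeffInt, if_pos (Int.natCast_nonneg _), Int.toNat_natCast] at h
    have hfactor : ((List.range i.1).map
        ((fun a => PowerSeries.X + PowerSeries.C a) ∘ fun a => -t (a + 1))).prod =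
        ∏ m ∈ Finset.range i, (PowerSeries.X - PowerSeries.C (t (m + 1))) := by
      rw [Finset.prod_range, ← List.prod_ofFn, List.ofFn_eq_map, ← List.map_coe_finRange_eq_range,
        List.map_map]
      congr 2
      funext m
      simp [sub_eq_add_neg]
    rw [hfactor] at h
    refine h.symm.trans (finsum_congr fun k => ?_)
    congr 2
    simp only [List.length_map, List.length_range]
    push_cast
    ring
  refine ⟨?_, hsnd⟩
  rw [hsnd]
  congr 1
  ext i j
  have h := finsum_eInt_mul_hL ((List.range i.1).map fun a => -t (a + 1))
    ((List.range n).map fun a => x (a + 1)) ((lam i : ℤ) - i + j)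
  simp only [Matrix.of_apply]
  convert h.symm using 5 <;> ring

end
end
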